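/- Under the hypotheses of the deformation lemma (X = Y ⊕ Z as in the setup; φ ∈ C¹(X, ℝ) even with ∇φ weakly sequentially continuous; d_k := sup{φ(u) : u ∈ Y_k, ‖u‖ ≤ ρ_k} < ∞; a_k := sup{φ(u) : u ∈ Y_k, ‖u‖ = ρ_k} < inf{φ(u) : u ∈ Z_k, ‖u‖ ≤ r_k}; b_k := inf{φ(u) : u ∈ Z_k, ‖u‖ = r_k} > sup{φ(u) : ‖u‖_τ < δ} for some δ > 0; ε ∈ (0, 1/2) with 0 < ε < b_k − max{a_k, sup{φ(u) : ‖u‖_τ < δ}}; and ‖φ'(u)‖ > ε for all u in E = {u : φ(u) ≤ d_k + 1, ‖u‖_τ ≥ δ/2}), set R = 2(d_k − b_k + 2ε)/ε + ρ_k + δ and B_R = {u ∈ X : ‖u‖ ≤ R}. Then there exists a vector field χ : {u ∈ X : φ(u) ≤ d_k + ε} → X such that: (a) χ is odd, ‖χ(u)‖ ≤ 2/ε and ⟨∇φ(u), χ(u)⟩ ≤ 0 for all u with φ(u) ≤ d_k + ε; (b) χ is locally Lipschitz continuous and τ-locally Lipschitz τ-continuous on {φ ≤ d_k + ε}; (c)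 ⟨∇φ(u), χ(u)⟩ < −1 for every u ∈ φ^{-1}([b_k − ε, d_k + ε)) ∩ B_R; and (d) χ(u) = 0 whenever ‖u‖_τ ≤ 2δ/3, and every point has a τ-open neighborhood whose image under χ is contained in a finite-dimensional subspace of X. -/

import Mathlib

open Filter Topology Metric Set
open scoped RealInnerProductSpace

noncomputable section

/-- The setup of the fountain theorem: a separable Hilbert space `X = Y ⊕ Z`,
where `Y` is a closed subspace with orthonormal (topological) basis `e`,
`Z = Yᗮ` has orthonormal (topological) basis `f`, and `P`, `Q` are the
orthogonal projections onto `Y` and `Z` respectively. -/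
structure FountainSetup (X : Type*) [NormedAddCommGroup X] [InnerProductSpace ℝ X]
    [CompleteSpace X] : Type _ where
  separable : TopologicalSpace.SeparableSpace X
  Y : Submodule ℝ X
  closedY : IsClosed (Y : Set X)
  e : ℕ → X
  f : ℕ → X
  orth_e : Orthonormal ℝ e
  orth_f : Orthonormal ℝ f
  e_mem : ∀ j, e j ∈ Y
  f_mem : ∀ j, f j ∈ Yᗮ
  span_e : (Submodule.span ℝ (Set.range e)).topologicalClosure = Y
  span_f : (Submodule.span ℝ (Set.range f)).topologicalClosure = Yᗮ
  P : X →L[ℝ] X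
  Q : X →L[ℝ] X
  P_mem : ∀ u, P u ∈ Y
  Q_mem : ∀ u, Q u ∈ Yᗮ
  P_add_Q : ∀ u, P u + Q u = u

namespace FountainSetup

variable {X : Type*} [NormedAddCommGroup X] [InnerProductSpace ℝ X] [CompleteSpace X]
variable (S : FountainSetup X)

/-- `Y_k = Y ⊕ (⊕_{j=0}^{k} ℝ f_j)`. -/
def Yk (k : ℕ) : Submodule ℝ X := S.Y ⊔ Submodule.span ℝ (S.f '' {j | j ≤ k})

/-- `Z_k` = closure of `⊕_{j=k}^{∞} ℝ f_j`. -/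
def Zk (k : ℕ) : Submodule ℝ X :=
  (Submodule.span ℝ (S.f '' {j | k ≤ j})).topologicalClosure

/-- The τ-norm `‖u‖_τ = max { Σ_j 2^{-(j+1)} |⟨Pu, e_j⟩| , ‖Qu‖ }`. -/
def tauNorm (u : X) : ℝ :=
  max (∑' j : ℕ, (1 / 2 : ℝ) ^ (j + 1) * |⟪S.P u, S.e j⟫|) ‖S.Q u‖

/-- Convergence of a sequence in the τ-topology (which is induced by the norm `tauNorm`,
hence metrizable, so sequential convergence describes it completely). -/
def TauTendsto (u : ℕ → X) (v : X) : Prop :=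
  Tendsto (fun n => S.tauNorm (u n - v)) atTop (𝓝 0)

end FountainSetup

/-- Weak convergence of a sequence in a Hilbert space. -/
def WeakConv {X : Type*} [NormedAddCommGroup X] [InnerProductSpace ℝ X]
    (u : ℕ → X) (v : X) : Prop :=
  ∀ w : X, Tendsto (fun n => ⟪u n, w⟫) atTop (𝓝 ⟪v, w⟫)

/-- `∇φ` is weakly sequentially continuous: `φ'(u_n) v → φ'(u) v` for all `v`
whenever `u_n ⇀ u` weakly. -/
def WeaklySeqContDeriv {X : Type*} [NormedAddCommGroup X] [InnerProductSpace ℝ X]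
    (φ' : X → X →L[ℝ] ℝ) : Prop :=
  ∀ (u : ℕ → X) (v : X), WeakConv u v →
    ∀ w : X, Tendsto (fun n => φ' (u n) w) atTop (𝓝 (φ' v w))

/-! ### Chains of lists modulo two -/

/-- Formal sums modulo two of lists of points, graded by length and augmented by the empty list. -/
abbrev ListChain (E : Type*) := List E →₀ ZMod 2

namespace ListChain

variable {E : Type*}

/-- The linear map which prepends a vertex to every list. -/
def cone (v : E) : ListChain E →ₗ[ZMod 2] ListChain E :=
  Finsupp.lmapDomain (ZMod 2) (ZMod 2) (List.cons v)

@[simp]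
lemma cone_single (v : E) (l : List E) :
    cone v (Finsupp.single l 1) = Finsupp.single (v :: l) 1 := by
  simp [cone, Finsupp.mapDomain_single]

/-- The sum of the faces of a list. -/
def faces : List E → ListChain E
  | [] => 0
  | v :: l => Finsupp.single l 1 + cone v (faces l)

/-- The boundary operator. -/
def boundary : ListChain E →ₗ[ZMod 2] ListChain E :=
  Finsupp.linearCombination (ZMod 2) faces

@[simp]
lemma boundary_single (l : List E) : boundary (Finsupp.single l 1) = faces l := by
  simp [boundary]

lemma boundary_cone (v : E) (c : ListChain E) : boundary (cone v c) = c + cone v (boundary c) := by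
  have : boundary ∘ₗ cone v = LinearMap.id + cone v ∘ₗ boundary (E := E) := by
    refine Finsupp.lhom_ext' fun l => LinearMap.ext_ring ?_
    simp [faces]
  exact LinearMap.congr_fun this c

lemma boundary_faces (l : List E) : boundary (faces l) = 0 := by
  induction l with
  | nil => simp [faces]
  | cons v l ih => simp [faces, boundary_cone, ih, ZModModule.add_self]

/-- A linear map which sends the generators in `s` to `N` sends chains supported in `s` to `N`. -/
lemma map_mem_of_mem_supported {M : Type*} [AddCommGroup M] [Module (ZMod 2) M]
    {s : Set (List E)} {N : Submodule (ZMod 2) M} {L : ListChain E →ₗ[ZMod 2] M}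
    (h : ∀ l ∈ s, L (Finsupp.single l 1) ∈ N) {c : ListChain E}
    (hc : c ∈ Finsupp.supported (ZMod 2) (ZMod 2) s) : L c ∈ N := by
  rw [Finsupp.supported_eq_span_single] at hc
  refine (Submodule.span_le.2 ?_ : Submodule.span (ZMod 2) _ ≤ N.comap L) hc
  rintro _ ⟨l, hl, rfl⟩
  exact h l hl

lemma single_mem_supported {s : Set (List E)} {l : List E} (hl : l ∈ s) :
    (Finsupp.single l 1 : ListChain E) ∈ Finsupp.supported (ZMod 2) (ZMod 2) s :=
  Finsupp.single_mem_supported _ _ hl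

lemma cone_mem_supported {v : E} {s t : Set (List E)} (h : ∀ l ∈ s, v :: l ∈ t)
    {c : ListChain E} (hc : c ∈ Finsupp.supported (ZMod 2) (ZMod 2) s) :
    cone v c ∈ Finsupp.supported (ZMod 2) (ZMod 2) t :=
  map_mem_of_mem_supported (fun l hl => by
    rw [cone_single]; exact single_mem_supported (h l hl)) hc

lemma faces_mem_supported (l : List E) :
    faces l ∈ Finsupp.supported (ZMod 2) (ZMod 2)
      {τ : List E | τ.length + 1 = l.length ∧ τ ⊆ l} := by
  induction l with
  | nil => exact Submodule.zero_mem _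
  | cons v l ih =>
    refine Submodule.add_mem _ (single_mem_supported ⟨rfl, List.subset_cons_self v l⟩)
      (cone_mem_supported ?_ ih)
    rintro τ ⟨hτ, hsub⟩
    exact ⟨by simp [hτ], List.cons_subset_cons v hsub⟩

section Antipode

variable [AddCommGroup E]

/-- The map induced on chains by the antipodal map. -/
def antipode : ListChain E →ₗ[ZMod 2] ListChain E :=
  Finsupp.lmapDomain (ZMod 2) (ZMod 2) (List.map fun x => -x)

@[simp]
lemma antipode_single (l : List E) :
    antipode (Finsupp.single l 1) = Finsupp.single (l.map fun x => -x) 1 := by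
  simp [antipode, Finsupp.mapDomain_single]

lemma antipode_cone (v : E) (c : ListChain E) : antipode (cone v c) = cone (-v) (antipode c) := by
  have : antipode ∘ₗ cone v = cone (-v) ∘ₗ antipode := by
    refine Finsupp.lhom_ext' fun l => LinearMap.ext_ring ?_
    simp
  exact LinearMap.congr_fun this c

lemma faces_map_neg (l : List E) : faces (l.map fun x => -x) = antipode (faces l) := by
  induction l with
  | nil => simp [faces]
  | cons v l ih => simp [faces, antipode_cone, ih]

lemma boundary_antipode (c : ListChain E) : boundary (antipode c) = antipode (boundary c) := by
  have : boundary ∘ₗ antipode = antipode ∘ₗ boundary (E := E) := by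
    refine Finsupp.lhom_ext' fun l => LinearMap.ext_ring ?_
    simp [faces_map_neg]
  exact LinearMap.congr_fun this c

lemma antipode_antipode (c : ListChain E) : antipode (antipode c) = c := by
  have : antipode ∘ₗ antipode = LinearMap.id (R := ZMod 2) (M := ListChain E) := by
    refine Finsupp.lhom_ext' fun l => LinearMap.ext_ring ?_
    simp [Function.comp_def]
  exact LinearMap.congr_fun this c

end Antipode

/-! ### Cup products of coboundaries of sign functions -/

section Cochain

variable (q : ℕ → E → ZMod 2)

/-- The cup product `δ(q i) ∪ δ(q (i + 1)) ∪ ⋯`, with as many factors as the list has edges. -/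
def cup : ℕ → List E → ZMod 2
  | _, [] => 0
  | _, [_] => 1
  | i, u :: v :: l => (q i u + q i v) * cup (i + 1) (v :: l)

/-- The cup product `q i ∪ δ(q (i + 1)) ∪ δ(q (i + 2)) ∪ ⋯`. -/
def halfCup (i : ℕ) : List E → ZMod 2
  | [] => 1
  | v :: l => q i v * cup q (i + 1) (v :: l)

/-- Evaluation of `cup` on chains. -/
def cupEval (i : ℕ) : ListChain E →ₗ[ZMod 2] ZMod 2 :=
  Finsupp.linearCombination (ZMod 2) (cup q i)

/-- Evaluation of `halfCup` on chains. -/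
def halfCupEval (i : ℕ) : ListChain E →ₗ[ZMod 2] ZMod 2 :=
  Finsupp.linearCombination (ZMod 2) (halfCup q i)

@[simp]
lemma cupEval_single (i : ℕ) (l : List E) : cupEval q i (Finsupp.single l 1) = cup q i l := by
  simp [cupEval]

@[simp]
lemma halfCupEval_single (i : ℕ) (l : List E) :
    halfCupEval q i (Finsupp.single l 1) = halfCup q i l := by
  simp [halfCupEval]

lemma cupEval_cone_cone (i : ℕ) (u v : E) (c : ListChain E) :
    cupEval q i (cone u (cone v c)) = (q i u + q i v) * cupEval q (i + 1) (cone v c) := by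
  have : cupEval q i ∘ₗ cone u ∘ₗ cone v = (q i u + q i v) • cupEval q (i + 1) ∘ₗ cone v := by
    refine Finsupp.lhom_ext' fun l => LinearMap.ext_ring ?_
    simp [cup]
  exact LinearMap.congr_fun this c

lemma halfCupEval_cone (i : ℕ) (v : E) (c : ListChain E) :
    halfCupEval q i (cone v c) = q i v * cupEval q (i + 1) (cone v c) := by
  have : halfCupEval q i ∘ₗ cone v = q i v • cupEval q (i + 1) ∘ₗ cone v := by
    refine Finsupp.lhom_ext' fun l => LinearMap.ext_ring ?_
    simp [halfCup]
  exact LinearMap.congr_fun this c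

lemma cupEval_faces (i : ℕ) (u v : E) (l : List E) : cupEval q i (faces (u :: v :: l)) = 0 := by
  induction l generalizing i u v with
  | nil => simp [faces, cup, CharTwo.add_self_eq_zero]
  | cons x l ih =>
    have h := ih (i + 1) v x
    rw [faces, map_add, cupEval_single] at h
    rw [faces, map_add, cupEval_single, faces, map_add, map_add, cone_single, cupEval_single,
      cupEval_cone_cone, cup, cup, (CharTwo.add_eq_zero.1 h).symm]
    linear_combination (q i v + q i u + q i x) * cup q (i + 1) (x :: l) *
      (CharTwo.two_eq_zero (R := ZMod 2))

lemma halfCupEval_faces (i : ℕ) {l : List E} (hl : l ≠ []) :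
    halfCupEval q i (faces l) = cup q i l := by
  match l, hl with
  | [v], _ => simp [faces, halfCup, cup]
  | u :: v :: l, _ =>
    have h := cupEval_faces q (i + 1) u v l
    rw [faces, map_add, cupEval_single] at h
    have h' : cupEval q (i + 1) (cone u (faces (v :: l))) = cup q (i + 1) (v :: l) :=
      (CharTwo.add_eq_zero.1 h).symm
    rw [faces, map_add, halfCupEval_single, halfCupEval_cone, h', halfCup, cup]
    ring

lemma exists_ne_of_cup_ne_zero {l : List E} {i : ℕ} (h : cup q i l ≠ 0) {j : ℕ} (hij : i ≤ j)
    (hj : j + 1 < i + l.length) : ∃ u ∈ l, ∃ v ∈ l, q j u ≠ q j v := by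
  induction l generalizing i with
  | nil => simp [cup] at h
  | cons u l ih =>
    match l with
    | [] => simp at hj; omega
    | v :: l =>
      rw [cup] at h
      rcases hij.eq_or_lt with rfl | hlt
      · refine ⟨u, by simp, v, by simp, fun huv => left_ne_zero_of_mul h ?_⟩
        rw [huv, CharTwo.add_self_eq_zero]
      · obtain ⟨x, hx, y, hy, hxy⟩ := ih (right_ne_zero_of_mul h) hlt
          (by simp only [List.length_cons] at hj ⊢; omega)
        exact ⟨x, List.mem_cons_of_mem _ hx, y, List.mem_cons_of_mem _ hy, hxy⟩

variable {q} [AddCommGroup E]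

lemma cup_map_neg (hq : ∀ i x, x ≠ 0 → q i (-x) = q i x + 1) (i : ℕ) {l : List E}
    (hl : ∀ v ∈ l, v ≠ 0) :
    cup q i (l.map fun x => -x) = cup q i l := by
  induction l generalizing i with
  | nil => simp [cup]
  | cons u l ih =>
    match l with
    | [] => simp [cup]
    | v :: l =>
      have := ih (i + 1) fun w hw => hl w (List.mem_cons_of_mem _ hw)
      simp only [List.map_cons, cup] at this ⊢
      rw [this, hq i u (hl u (by simp)), hq i v (hl v (by simp))]
      linear_combination cup q (i + 1) (v :: l) * (CharTwo.two_eq_zero (R := ZMod 2))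

lemma halfCup_map_neg (hq : ∀ i x, x ≠ 0 → q i (-x) = q i x + 1) (i : ℕ) {l : List E}
    (hne : l ≠ []) (hl : ∀ v ∈ l, v ≠ 0) :
    halfCup q i (l.map fun x => -x) = halfCup q i l + cup q (i + 1) l := by
  match l, hne with
  | v :: l, _ =>
    have := cup_map_neg hq (i + 1) hl
    simp only [List.map_cons, halfCup] at this ⊢
    rw [this, hq i v (hl v (by simp))]
    ring

/-- The cup product of sign functions evaluates to one on a hemisphere. -/
lemma cupEval_hemisphere (hq : ∀ i x, x ≠ 0 → q i (-x) = q i x + 1)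
    {h s : ℕ → ListChain E} (hbd : ∀ j, boundary (h j) = s j)
    (h0 : s 0 = Finsupp.single [] 1) (hs : ∀ j, s (j + 1) = h j + antipode (h j)) {n : ℕ}
    (hsupp : ∀ j ≤ n, h j ∈ Finsupp.supported (ZMod 2) (ZMod 2)
      {l : List E | l ≠ [] ∧ ∀ v ∈ l, v ≠ 0}) (i : ℕ) : cupEval q i (h n) = 1 := by
  have key : ∀ j ≤ n, ∀ i, cupEval q i (h j) = halfCupEval q i (s j) := fun j hj i => by
    have : (cupEval q i - halfCupEval q i ∘ₗ boundary) (h j) ∈ (⊥ : Submodule (ZMod 2) (ZMod 2)) :=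
      map_mem_of_mem_supported (fun l hl => by
        simp [halfCupEval_faces q i hl.1]) (hsupp j hj)
    rw [← hbd]
    simpa [sub_eq_zero] using this
  induction n generalizing i with
  | zero => simp [key 0 le_rfl, h0, halfCup]
  | succ n ih =>
    have hanti : (halfCupEval q i + halfCupEval q i ∘ₗ antipode - cupEval q (i + 1)) (h n) ∈
        (⊥ : Submodule (ZMod 2) (ZMod 2)) :=
      map_mem_of_mem_supported (fun l hl => by
        simp only [LinearMap.sub_apply, LinearMap.add_apply, LinearMap.comp_apply,
          antipode_single, halfCupEval_single, cupEval_single, halfCup_map_neg hq i hl.1 hl.2,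
          Submodule.mem_bot]
        linear_combination halfCup q i l * (CharTwo.two_eq_zero (R := ZMod 2)))
        (hsupp n n.le_succ)
    rw [key _ le_rfl, hs, map_add]
    have := ih (fun j hj => hsupp j (hj.trans n.le_succ)) (i + 1)
      (fun j hj => key j (hj.trans n.le_succ))
    simp only [LinearMap.sub_apply, LinearMap.add_apply, LinearMap.comp_apply,
      Submodule.mem_bot] at hanti
    rw [sub_eq_zero.1 hanti, this]

end Cochain

end ListChain

/-! ### Barycentric subdivision -/

namespace ListChain

section Subdivision

variable {E : Type*} [NormedAddCommGroup E] [NormedSpace ℝ E]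

/-- The barycenter of a list of points. -/
def barycenter (l : List E) : E := (l.length : ℝ)⁻¹ • l.sum

lemma barycenter_map_neg (l : List E) : barycenter (l.map fun x => -x) = -barycenter l := by
  have : (l.map fun x => -x).sum = -l.sum := by
    induction l with
    | nil => simp
    | cons v l ih => simp [ih, add_comm]
  simp [barycenter, this]

lemma barycenter_mem {l : List E} (hl : l ≠ []) : barycenter l ∈ convexHull ℝ {x | x ∈ l} := by
  have hpos : (0 : ℝ) < l.length := by
    exact_mod_cast List.length_pos_iff.2 hl
  have : barycenter l = ∑ i : Fin l.length, (l.length : ℝ)⁻¹ • l[(i : ℕ)] := by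
    rw [barycenter, ← Finset.smul_sum, Fin.sum_univ_getElem]
  rw [this]
  refine (convex_convexHull ℝ _).sum_mem (fun _ _ => by positivity) ?_
    fun i _ => subset_convexHull ℝ _ (List.getElem_mem _)
  simp [hpos.ne']

lemma dist_barycenter_le {l : List E} {D : ℝ} (hD : ∀ u ∈ l, ∀ v ∈ l, dist u v ≤ D) {x : E}
    (hx : x ∈ convexHull ℝ {x | x ∈ l}) :
    dist x (barycenter l) ≤ (1 - (l.length : ℝ)⁻¹) * D := by
  suffices h : {x | x ∈ l} ⊆ closedBall (barycenter l) ((1 - (l.length : ℝ)⁻¹) * D) from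
    convexHull_min h (convex_closedBall _ _) hx
  intro v hv
  obtain ⟨k, hk, rfl⟩ := List.mem_iff_getElem.1 hv
  have hpos : (0 : ℝ) < l.length := by exact_mod_cast (Nat.zero_le k).trans_lt hk
  have hsub : l[k] - barycenter l =
      (l.length : ℝ)⁻¹ • ∑ i : Fin l.length, (l[k] - l[(i : ℕ)]) := by
    rw [Finset.sum_sub_distrib, Fin.sum_univ_getElem, smul_sub, barycenter]
    simp [← Nat.cast_smul_eq_nsmul ℝ, smul_smul, hpos.ne']
  have hsum : ∑ i : Fin l.length, ‖l[k] - l[(i : ℕ)]‖ ≤ (l.length - 1) * D := by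
    rw [← Finset.add_sum_erase _ _ (Finset.mem_univ (⟨k, hk⟩ : Fin l.length))]
    have : ∑ i ∈ Finset.univ.erase (⟨k, hk⟩ : Fin l.length), ‖l[k] - l[(i : ℕ)]‖ ≤
        (Finset.univ.erase (⟨k, hk⟩ : Fin l.length)).card • D :=
      Finset.sum_le_card_nsmul _ _ _ fun i _ => by
        rw [← dist_eq_norm]; exact hD _ hv _ (List.getElem_mem _)
    rw [Finset.card_erase_of_mem (Finset.mem_univ _), Finset.card_univ, Fintype.card_fin,
      nsmul_eq_mul, Nat.cast_sub (by omega), Nat.cast_one] at this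
    simpa using this
  rw [mem_closedBall, dist_eq_norm, hsub, norm_smul, Real.norm_of_nonneg (by positivity)]
  calc (l.length : ℝ)⁻¹ * ‖∑ i : Fin l.length, (l[k] - l[(i : ℕ)])‖
      ≤ (l.length : ℝ)⁻¹ * ((l.length - 1) * D) := by
        gcongr; exact (norm_sum_le _ _).trans hsum
    _ = (1 - (l.length : ℝ)⁻¹) * D := by field_simp

/-- The barycentric subdivision of chains of lists of length at most `k`. -/
def subdiv : ℕ → ListChain E →ₗ[ZMod 2] ListChain E
  | 0 => LinearMap.id
  | k + 1 => Finsupp.linearCombination (ZMod 2) fun l =>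
      if l = [] then Finsupp.single [] 1 else cone (barycenter l) (subdiv k (faces l))

lemma subdiv_succ_single (k : ℕ) {l : List E} (hl : l ≠ []) :
    subdiv (k + 1) (Finsupp.single l 1) = cone (barycenter l) (subdiv k (faces l)) := by
  simp [subdiv, hl]

lemma boundary_subdiv (k : ℕ) (c : ListChain E) :
    boundary (subdiv (k + 1) c) = subdiv k (boundary c) := by
  suffices h : boundary ∘ₗ subdiv (k + 1) = subdiv k ∘ₗ boundary (E := E) from
    LinearMap.congr_fun h c
  refine Finsupp.lhom_ext' fun l => LinearMap.ext_ring ?_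
  by_cases hl : l = []
  · simp [hl, subdiv, faces]
  · have hzero : boundary (subdiv k (faces l)) = 0 := by
      cases k with
      | zero => exact boundary_faces l
      | succ k => rw [boundary_subdiv k, boundary_faces, map_zero]
    simp [subdiv_succ_single k hl, boundary_cone, hzero]

lemma subdiv_antipode (k : ℕ) (c : ListChain E) :
    subdiv k (antipode c) = antipode (subdiv k c) := by
  induction k generalizing c with
  | zero => rfl
  | succ k ih =>
    suffices h : subdiv (k + 1) ∘ₗ antipode = antipode ∘ₗ subdiv (E := E) (k + 1) from
      LinearMap.congr_fun h c
    refine Finsupp.lhom_ext' fun l => LinearMap.ext_ring ?_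
    by_cases hl : l = []
    · simp [hl, subdiv]
    · have hl' : (l.map fun x => -x) ≠ [] := by simpa using hl
      simp [subdiv_succ_single k hl, subdiv_succ_single k hl', faces_map_neg, antipode_cone, ih,
        barycenter_map_neg]

lemma subdiv_single_mem {J : ℕ} {D : ℝ} (hD0 : 0 ≤ D) (k : ℕ) (hkJ : k ≤ J) (l : List E)
    (hl : l.length = k) (hD : ∀ u ∈ l, ∀ v ∈ l, dist u v ≤ D) :
    subdiv k (Finsupp.single l 1) ∈ Finsupp.supported (ZMod 2) (ZMod 2)
      {τ : List E | τ.length = k ∧ (∀ v ∈ τ, v ∈ convexHull ℝ {x | x ∈ l}) ∧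
        ∀ u ∈ τ, ∀ v ∈ τ, dist u v ≤ (1 - (J : ℝ)⁻¹) * D} := by
  induction k generalizing l with
  | zero =>
    obtain rfl := List.length_eq_zero_iff.1 hl
    exact single_mem_supported (by simp)
  | succ k ih =>
    have hne : l ≠ [] := by rintro rfl; simp at hl
    have hJ : (1 : ℝ) ≤ J := by exact_mod_cast (Nat.succ_le_succ k.zero_le).trans hkJ
    have hle : (1 - (l.length : ℝ)⁻¹) * D ≤ (1 - (J : ℝ)⁻¹) * D := by
      have hlJ : (l.length : ℝ) ≤ J := by exact_mod_cast hl.trans_le hkJ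
      have hl0 : (0 : ℝ) < l.length := by rw [hl]; positivity
      gcongr
    have hnn : 0 ≤ (1 - (J : ℝ)⁻¹) * D :=
      mul_nonneg (sub_nonneg.2 (inv_le_one_of_one_le₀ hJ)) hD0
    rw [subdiv_succ_single k hne]
    refine cone_mem_supported (s := {τ : List E | τ.length = k ∧
      (∀ v ∈ τ, v ∈ convexHull ℝ {x | x ∈ l}) ∧
        ∀ u ∈ τ, ∀ v ∈ τ, dist u v ≤ (1 - (J : ℝ)⁻¹) * D}) ?_ ?_
    · rintro τ ⟨hτ, hmem, hdist⟩
      refine ⟨by simp [hτ], ?_, ?_⟩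
      · simp only [List.mem_cons, forall_eq_or_imp]
        exact ⟨barycenter_mem hne, hmem⟩
      · simp only [List.mem_cons, forall_eq_or_imp, dist_self]
        refine ⟨⟨hnn, fun v hv => ?_⟩, fun u hu =>
          ⟨(dist_barycenter_le hD (hmem u hu)).trans hle, hdist u hu⟩⟩
        rw [dist_comm]
        exact (dist_barycenter_le hD (hmem v hv)).trans hle
    · refine map_mem_of_mem_supported ?_ (faces_mem_supported l)
      rintro τ ⟨hτ, hsub⟩
      refine Finsupp.supported_mono ?_ (ih (by omega) τ (by omega)
        fun u hu v hv => hD u (hsub hu) v (hsub hv))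
      rintro σ ⟨h₁, h₂, h₃⟩
      exact ⟨h₁, fun v hv => convexHull_mono (fun x hx => hsub hx) (h₂ v hv), h₃⟩

lemma subdiv_iterate_mem {J : ℕ} {D : ℝ} (hD0 : 0 ≤ D) {k : ℕ} (hk : 0 < k) (hkJ : k ≤ J)
    {𝒦 : Set (Set E)} (h𝒦 : ∀ K ∈ 𝒦, Convex ℝ K) {c : ListChain E}
    (hc : c ∈ Finsupp.supported (ZMod 2) (ZMod 2) {τ : List E | τ.length = k ∧
      (∃ K ∈ 𝒦, ∀ v ∈ τ, v ∈ K) ∧ ∀ u ∈ τ, ∀ v ∈ τ, dist u v ≤ D}) (m : ℕ) :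
    (subdiv k)^[m] c ∈ Finsupp.supported (ZMod 2) (ZMod 2) {τ : List E | τ.length = k ∧
      (∃ K ∈ 𝒦, ∀ v ∈ τ, v ∈ K) ∧ ∀ u ∈ τ, ∀ v ∈ τ, dist u v ≤ (1 - (J : ℝ)⁻¹) ^ m * D} := by
  have hJ : (1 : ℝ) ≤ J := by exact_mod_cast (Nat.succ_le_of_lt hk).trans hkJ
  have hnn : 0 ≤ 1 - (J : ℝ)⁻¹ := sub_nonneg.2 (inv_le_one_of_one_le₀ hJ)
  induction m with
  | zero => simpa using hc
  | succ m ih =>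
    rw [Function.iterate_succ_apply']
    refine map_mem_of_mem_supported ?_ ih
    rintro l ⟨hl, ⟨K, hK, hlK⟩, hD⟩
    refine Finsupp.supported_mono ?_ (subdiv_single_mem (by positivity) k hkJ l hl hD)
    rintro σ ⟨h₁, h₂, h₃⟩
    refine ⟨h₁, ⟨K, hK, fun v hv => convexHull_min (fun x hx => hlK x hx) (h𝒦 K hK) (h₂ v hv)⟩,
      fun u hu v hv => (h₃ u hu v hv).trans_eq (by ring)⟩

end Subdivision

end ListChain

/-! ### The Borsuk–Ulam theorem -/

namespace ListChain

section Sphere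

variable {E : Type*} [AddCommGroup E]

/-- The sphere of dimension `j - 1` as the boundary of the cross-polytope spanned by
`e 0, …, e (j - 1)`. -/
def sphere (e : ℕ → E) : ℕ → ListChain E
  | 0 => Finsupp.single [] 1
  | j + 1 => cone (e j) (sphere e j) + antipode (cone (e j) (sphere e j))

lemma boundary_sphere (e : ℕ → E) (j : ℕ) : boundary (sphere e j) = 0 := by
  induction j with
  | zero => simp [sphere, faces]
  | succ j ih =>
    rw [sphere, map_add, boundary_antipode, boundary_cone, ih, map_zero, add_zero]
    cases j with
    | zero => simp [sphere, ZModModule.add_self]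
    | succ j =>
      rw [sphere, map_add, antipode_antipode, add_comm (antipode _), ZModModule.add_self]

lemma boundary_hemisphere (e : ℕ → E) (j : ℕ) :
    boundary (cone (e j) (sphere e j)) = sphere e j := by
  rw [boundary_cone, boundary_sphere, map_zero, add_zero]

end Sphere

variable {n : ℕ}

/-- The part of the unit ball of `ℝⁿ⁺¹` on a hyperplane `∑ i, s i * v i = 1`. -/
def slice (s : Fin (n + 1) → ℝ) : Set (Fin (n + 1) → ℝ) :=
  {v | ∑ i, s i * v i = 1 ∧ ‖v‖ ≤ 1}

lemma convex_slice (s : Fin (n + 1) → ℝ) : Convex ℝ (slice s) := by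
  rintro v ⟨hv, hv'⟩ w ⟨hw, hw'⟩ a b ha hb hab
  refine ⟨?_, ?_⟩
  · calc ∑ i, s i * (a • v + b • w) i
        = a * ∑ i, s i * v i + b * ∑ i, s i * w i := by
          rw [Finset.mul_sum, Finset.mul_sum, ← Finset.sum_add_distrib]
          refine Finset.sum_congr rfl fun i _ => ?_
          simp only [Pi.add_apply, Pi.smul_apply, smul_eq_mul]
          ring
      _ = 1 := by rw [hv, hw, mul_one, mul_one, hab]
  · have := convex_closedBall (0 : Fin (n + 1) → ℝ) 1 (mem_closedBall_zero_iff.2 hv')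
      (mem_closedBall_zero_iff.2 hw') ha hb hab
    exact mem_closedBall_zero_iff.1 this

lemma inv_le_norm_of_mem_slice {s : Fin (n + 1) → ℝ} (hs : ∀ i, |s i| ≤ 1)
    {v : Fin (n + 1) → ℝ} (hv : v ∈ slice s) : ((n : ℝ) + 1)⁻¹ ≤ ‖v‖ := by
  have h1 : (1 : ℝ) ≤ (n + 1) * ‖v‖ := by
    calc (1 : ℝ) = ∑ i, s i * v i := hv.1.symm
      _ ≤ ∑ _i : Fin (n + 1), ‖v‖ := Finset.sum_le_sum fun i _ => by
        calc s i * v i ≤ |s i| * |v i| := (le_abs_self _).trans_eq (abs_mul _ _)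
          _ ≤ 1 * ‖v‖ := mul_le_mul (hs i) (norm_le_pi_norm v i) (abs_nonneg _) zero_le_one
          _ = ‖v‖ := one_mul _
      _ = (n + 1) * ‖v‖ := by simp
  rwa [inv_le_iff_one_le_mul₀' (by positivity)]

/-- The standard basis of `ℝⁿ⁺¹`, extended by zero. -/
def stdVec (n j : ℕ) : Fin (n + 1) → ℝ := fun i => if (i : ℕ) = j then 1 else 0

lemma sphere_mem_supported {j : ℕ} (hj : j ≤ n + 1) :
    sphere (stdVec n) j ∈ Finsupp.supported (ZMod 2) (ZMod 2)
      {τ : List (Fin (n + 1) → ℝ) | τ.length = j ∧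
        (∃ s : Fin (n + 1) → ℝ, (∀ i, |s i| ≤ 1) ∧ ∀ v ∈ τ, v ∈ slice s) ∧
        ∀ v ∈ τ, ∀ i : Fin (n + 1), j ≤ i → v i = 0} ∧
    ∀ i, i + 1 = j → cone (stdVec n i) (sphere (stdVec n) i) ∈
      Finsupp.supported (ZMod 2) (ZMod 2)
      {τ : List (Fin (n + 1) → ℝ) | τ.length = j ∧
        (∃ s : Fin (n + 1) → ℝ, (∀ i, |s i| ≤ 1) ∧ ∀ v ∈ τ, v ∈ slice s) ∧
        ∀ v ∈ τ, ∀ i : Fin (n + 1), j ≤ i → v i = 0} := by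
  induction j with
  | zero => exact ⟨single_mem_supported ⟨rfl, ⟨0, by simp, by simp⟩, by simp⟩, by simp⟩
  | succ j ih =>
    have hcone : cone (stdVec n j) (sphere (stdVec n) j) ∈ Finsupp.supported (ZMod 2) (ZMod 2)
        {τ : List (Fin (n + 1) → ℝ) | τ.length = j + 1 ∧
          (∃ s : Fin (n + 1) → ℝ, (∀ i, |s i| ≤ 1) ∧ ∀ v ∈ τ, v ∈ slice s) ∧
          ∀ v ∈ τ, ∀ i : Fin (n + 1), j + 1 ≤ i → v i = 0} := by
      refine cone_mem_supported ?_ (ih (by omega)).1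
      rintro τ ⟨hτ, ⟨s, hs, hsτ⟩, hzero⟩
      refine ⟨by simp [hτ], ⟨Function.update s ⟨j, hj⟩ 1, fun i => ?_, ?_⟩, ?_⟩
      · rcases eq_or_ne i ⟨j, hj⟩ with rfl | hi
        · simp
        · simpa [hi] using hs i
      · simp only [List.mem_cons, forall_eq_or_imp]
        refine ⟨⟨?_, ?_⟩, fun v hv => ⟨?_, (hsτ v hv).2⟩⟩
        · rw [Finset.sum_eq_single ⟨j, hj⟩]
          · simp [stdVec]
          · intro i _ hi
            have : (i : ℕ) ≠ j := fun h => hi (Fin.ext h)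
            simp [stdVec, this]
          · simp
        · refine (pi_norm_le_iff_of_nonneg zero_le_one).2 fun i => ?_
          unfold stdVec
          split_ifs <;> simp
        · rw [← (hsτ v hv).1]
          refine Finset.sum_congr rfl fun i _ => ?_
          rcases eq_or_ne i ⟨j, hj⟩ with rfl | hi
          · simp [hzero v hv ⟨j, hj⟩ le_rfl]
          · simp [hi]
      · simp only [List.mem_cons, forall_eq_or_imp]
        refine ⟨fun i hi => ?_, fun v hv i hi => hzero v hv i (by omega)⟩
        have : (i : ℕ) ≠ j := by omega
        simp [stdVec, this]
    refine ⟨Submodule.add_mem _ hcone (map_mem_of_mem_supported ?_ hcone), ?_⟩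
    · rintro τ ⟨hτ, ⟨s, hs, hsτ⟩, hzero⟩
      rw [antipode_single]
      refine single_mem_supported ⟨by simpa using hτ, ⟨-s, by simpa using hs, ?_⟩, ?_⟩
      · simp only [List.mem_map, forall_exists_index, and_imp, forall_apply_eq_imp_iff₂]
        intro v hv
        exact ⟨by simpa using (hsτ v hv).1, by simpa using (hsτ v hv).2⟩
      · simp only [List.mem_map, forall_exists_index, and_imp, forall_apply_eq_imp_iff₂]
        intro v hv i hi
        simp [hzero v hv i hi]
    · intro i hi
      obtain rfl : i = j := by omega
      exact hcone

/-- For odd sign functions `q 0, …, q (n - 1)` on `ℝⁿ⁺¹ \ {0}` there are arbitrarily small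
simplices on which all of them change sign. -/
lemma exists_small_simplex (q : ℕ → (Fin (n + 1) → ℝ) → ZMod 2)
    (hq : ∀ i x, x ≠ 0 → q i (-x) = q i x + 1) (m : ℕ) :
    ∃ τ : List (Fin (n + 1) → ℝ), (∀ v ∈ τ, ((n : ℝ) + 1)⁻¹ ≤ ‖v‖ ∧ ‖v‖ ≤ 1) ∧ τ ≠ [] ∧
      (∀ u ∈ τ, ∀ v ∈ τ, dist u v ≤ (1 - ((n + 1 : ℕ) : ℝ)⁻¹) ^ m * 2) ∧
      ∀ i < n, ∃ u ∈ τ, ∃ v ∈ τ, q i u ≠ q i v := by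
  set h : ℕ → ListChain (Fin (n + 1) → ℝ) := fun j =>
    (subdiv (j + 1))^[m] (cone (stdVec n j) (sphere (stdVec n) j)) with hh
  have hbd : ∀ j, boundary (h j) = (subdiv j)^[m] (sphere (stdVec n) j) := fun j => by
    have : Function.Semiconj boundary (subdiv (j + 1)) (subdiv (E := Fin (n + 1) → ℝ) j) :=
      boundary_subdiv j
    rw [hh]
    simp only
    rw [(this.iterate_right m) _, boundary_hemisphere]
  have hsupp : ∀ j ≤ n, h j ∈ Finsupp.supported (ZMod 2) (ZMod 2)
      {τ : List (Fin (n + 1) → ℝ) | τ.length = j + 1 ∧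
        (∃ K ∈ slice '' {s : Fin (n + 1) → ℝ | ∀ i, |s i| ≤ 1}, ∀ v ∈ τ, v ∈ K) ∧
        ∀ u ∈ τ, ∀ v ∈ τ, dist u v ≤ (1 - ((n + 1 : ℕ) : ℝ)⁻¹) ^ m * 2} := fun j hj => by
    refine subdiv_iterate_mem zero_le_two j.succ_pos (by omega) ?_
      (Finsupp.supported_mono ?_ ((sphere_mem_supported (n := n) (j := j + 1) (by omega)).2 j rfl))
      m
    · rintro _ ⟨s, -, rfl⟩
      exact convex_slice s
    · rintro τ ⟨hτ, ⟨s, hs, hsτ⟩, -⟩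
      refine ⟨hτ, ⟨_, ⟨s, hs, rfl⟩, hsτ⟩, fun u hu v hv => ?_⟩
      have := (hsτ u hu).2
      have := (hsτ v hv).2
      exact (dist_le_norm_add_norm u v).trans (by linarith)
  have hnorm : ∀ τ : List (Fin (n + 1) → ℝ),
      (∃ K ∈ slice '' {s : Fin (n + 1) → ℝ | ∀ i, |s i| ≤ 1}, ∀ v ∈ τ, v ∈ K) →
      ∀ v ∈ τ, ((n : ℝ) + 1)⁻¹ ≤ ‖v‖ ∧ ‖v‖ ≤ 1 := by
    rintro τ ⟨_, ⟨s, hs, rfl⟩, hτ⟩ v hv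
    exact ⟨inv_le_norm_of_mem_slice hs (hτ v hv), (hτ v hv).2⟩
  have hone : cupEval q 0 (h n) = 1 := by
    refine cupEval_hemisphere hq hbd ?_ ?_ (fun j hj => Finsupp.supported_mono ?_ (hsupp j hj)) 0
    · exact Function.iterate_fixed rfl m
    · intro j
      have hc : Function.Semiconj antipode (subdiv (j + 1))
          (subdiv (E := Fin (n + 1) → ℝ) (j + 1)) :=
        fun c => (subdiv_antipode (j + 1) c).symm
      rw [sphere, iterate_map_add, ← (hc.iterate_right m) _]
    · rintro τ ⟨hτ, hK, -⟩
      refine ⟨by rintro rfl; simp at hτ, fun v hv => ?_⟩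
      have := (hnorm τ hK v hv).1
      exact norm_pos_iff.1 (lt_of_lt_of_le (by positivity) this)
  obtain ⟨τ, hτ, hcup⟩ : ∃ τ ∈ (h n).support, cup q 0 τ ≠ 0 := by
    by_contra! hcon
    rw [cupEval, Finsupp.linearCombination_apply, Finsupp.sum,
      Finset.sum_eq_zero fun τ hτ => by rw [hcon τ hτ, smul_zero]] at hone
    exact zero_ne_one hone
  obtain ⟨hlen, hK, hdist⟩ := (Finsupp.mem_supported _ _).1 (hsupp n le_rfl) hτ
  refine ⟨τ, hnorm τ hK, by rintro rfl; simp at hlen, hdist, fun i hi => ?_⟩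
  exact exists_ne_of_cup_ne_zero q hcup i.zero_le (by omega)

end ListChain

/-- **Borsuk–Ulam theorem** in coordinates. -/
theorem borsuk_ulam_pi {n : ℕ} {f : (Fin (n + 1) → ℝ) → Fin n → ℝ} (hf : ContinuousOn f {0}ᶜ)
    (hodd : ∀ x, x ≠ 0 → f (-x) = -f x) : ∃ x, x ≠ 0 ∧ f x = 0 := by
  classical
  set r : (Fin (n + 1) → ℝ) → Fin (n + 1) → ℝ := fun x => (Quot.out s(x, -x)).1 with hr
  have hr_neg : ∀ x, r (-x) = r x := fun x => by
    simp only [hr, neg_neg, Sym2.eq_swap (a := -x) (b := x)]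
  have hr_or : ∀ x, r x = x ∨ r x = -x := fun x => Sym2.mem_iff.1 (Sym2.out_fst_mem s(x, -x))
  set q : ℕ → (Fin (n + 1) → ℝ) → ZMod 2 := fun i x =>
    if hi : i < n then
      if 0 < f x ⟨i, hi⟩ then 1 else if f x ⟨i, hi⟩ < 0 then 0 else if r x = x then 1 else 0
    else if r x = x then 1 else 0 with hq
  have hr_q : ∀ x, x ≠ 0 → (if r (-x) = -x then 1 else 0 : ZMod 2) =
      (if r x = x then 1 else 0) + 1 := fun x hx => by
    have hne : x ≠ -x := fun h => hx (self_eq_neg.1 h)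
    rw [hr_neg]
    rcases hr_or x with h | h
    · rw [h, if_neg hne, if_pos rfl, CharTwo.add_self_eq_zero]
    · rw [h, if_pos rfl, if_neg hne.symm, zero_add]
  have hq_neg : ∀ i x, x ≠ 0 → q i (-x) = q i x + 1 := fun i x hx => by
    simp only [hq]
    by_cases hi : i < n
    · simp only [hi, dif_pos, hodd x hx, Pi.neg_apply, Left.neg_pos_iff, Left.neg_neg_iff]
      rcases lt_trichotomy (f x ⟨i, hi⟩) 0 with h | h | h
      · simp [h, h.not_gt]
      · simpa [h] using hr_q x hx
      · simp [h, h.not_gt, CharTwo.add_self_eq_zero]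
    · simpa [hi] using hr_q x hx
  have hq_ne : ∀ (i : Fin n) (x y), q i x ≠ q i y → f x i * f y i ≤ 0 := by
    intro i x y hxy
    by_contra! hpos
    apply hxy
    simp only [hq, i.2, dif_pos, Fin.eta]
    rcases pos_and_pos_or_neg_and_neg_of_mul_pos hpos with ⟨h, h'⟩ | ⟨h, h'⟩
    · simp [h, h']
    · simp [h, h', h.not_gt, h'.not_gt]
  choose τ hnorm hne hdist hsign using ListChain.exists_small_simplex q hq_neg
  set S : Set (Fin (n + 1) → ℝ) := {v | ((n : ℝ) + 1)⁻¹ ≤ ‖v‖ ∧ ‖v‖ ≤ 1}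
  have hS : IsCompact S := by
    refine Metric.isCompact_of_isClosed_isBounded
      ((isClosed_le continuous_const continuous_norm).inter
        (isClosed_le continuous_norm continuous_const))
      ((isBounded_closedBall (x := 0) (r := 1)).subset fun v hv => ?_)
    simpa using hv.2
  have hS0 : ∀ v ∈ S, v ≠ 0 := fun v hv =>
    norm_pos_iff.1 (lt_of_lt_of_le (by positivity) hv.1)
  choose u hu w hw huw using fun m (i : Fin n) => hsign m i i.2
  obtain ⟨x, hxS, φ, hφ, hlim⟩ := hS.tendsto_subseq
    (x := fun m => (τ m).head (hne m)) fun m => hnorm m _ (List.head_mem _)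
  refine ⟨x, hS0 x hxS, funext fun i => ?_⟩
  have hmesh : Tendsto (fun m : ℕ => (1 - ((n + 1 : ℕ) : ℝ)⁻¹) ^ m * 2) atTop (𝓝 0) := by
    have hpos : (0 : ℝ) < ((n + 1 : ℕ) : ℝ)⁻¹ := by positivity
    have hle : ((n + 1 : ℕ) : ℝ)⁻¹ ≤ 1 := inv_le_one_of_one_le₀ (by simp)
    simpa using (tendsto_pow_atTop_nhds_zero_of_lt_one (sub_nonneg.2 hle)
      (by linarith)).mul_const 2
  have hconv : ∀ y : ℕ → Fin (n + 1) → ℝ, (∀ m, y m ∈ τ m) →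
      Tendsto (fun m => f (y (φ m)) i) atTop (𝓝 (f x i)) := by
    intro y hy
    have hyx : Tendsto (fun m => y (φ m)) atTop (𝓝 x) := by
      refine (tendsto_iff_of_dist ?_).2 hlim
      refine squeeze_zero (fun _ => dist_nonneg) (fun m => ?_) (hmesh.comp hφ.tendsto_atTop)
      exact hdist _ _ (hy _) _ (List.head_mem _)
    have hcont : ContinuousAt f x :=
      hf.continuousAt (isOpen_compl_singleton.mem_nhds (hS0 x hxS))
    exact (tendsto_pi_nhds.1 (hcont.tendsto.comp hyx)) i
  have := le_of_tendsto ((hconv _ fun m => hu m i).mul (hconv _ fun m => hw m i))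
    (Eventually.of_forall fun m => hq_ne i _ _ (huw _ i))
  exact mul_self_eq_zero.1 (le_antisymm this (mul_self_nonneg _))

/-- **Borsuk–Ulam theorem**: an odd map from `E \ {0}` to a space of smaller dimension has a
zero. -/
theorem borsuk_ulam {E F : Type*} [NormedAddCommGroup E] [NormedSpace ℝ E]
    [FiniteDimensional ℝ E] [NormedAddCommGroup F] [NormedSpace ℝ F] [FiniteDimensional ℝ F]
    (hdim : Module.finrank ℝ E = Module.finrank ℝ F + 1) {f : E → F}
    (hf : ContinuousOn f {0}ᶜ) (hodd : ∀ x, x ≠ 0 → f (-x) = -f x) : ∃ x, x ≠ 0 ∧ f x = 0 := by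
  let eE : (Fin (Module.finrank ℝ F + 1) → ℝ) ≃L[ℝ] E :=
    ContinuousLinearEquiv.ofFinrankEq (by simp [hdim])
  let eF : F ≃L[ℝ] (Fin (Module.finrank ℝ F) → ℝ) :=
    ContinuousLinearEquiv.ofFinrankEq (by simp)
  obtain ⟨x, hx, hfx⟩ := borsuk_ulam_pi (f := fun x => eF (f (eE x)))
    (eF.continuous.comp_continuousOn (hf.comp eE.continuous.continuousOn fun x hx => by
      simpa using hx)) fun x hx => by
      rw [map_neg, hodd _ (by simpa using hx), map_neg]
  exact ⟨eE x, by simpa using hx, by simpa using hfx⟩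

/-- The part of a subspace `V` in the ball of radius `ρ`, with the weak topology. -/
def WeakBall {X : Type*} [NormedAddCommGroup X] [InnerProductSpace ℝ X]
    (V : Submodule ℝ X) (ρ : ℝ) : Type _ := {u : X // u ∈ V ∧ ‖u‖ ≤ ρ}

namespace WeakBall

variable {X : Type*} [NormedAddCommGroup X] [InnerProductSpace ℝ X]
variable {V : Submodule ℝ X} {ρ : ℝ}

/-- The underlying vector. -/
def val (x : WeakBall V ρ) : X := Subtype.val x

theorem val_mem (x : WeakBall V ρ) : x.val ∈ V := x.2.1

theorem norm_val_le (x : WeakBall V ρ) : ‖x.val‖ ≤ ρ := x.2.2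

theorem val_injective : Function.Injective (val : WeakBall V ρ → X) := Subtype.val_injective

instance : Neg (WeakBall V ρ) := ⟨fun x => ⟨-x.val, V.neg_mem x.val_mem, by
  rw [norm_neg]; exact x.norm_val_le⟩⟩

@[simp] theorem val_neg (x : WeakBall V ρ) : (-x).val = -x.val := rfl

@[simp] protected theorem neg_neg (x : WeakBall V ρ) : - -x = x :=
  val_injective (by simp)

instance : TopologicalSpace (WeakBall V ρ) :=
  TopologicalSpace.induced (fun x (w : X) => ⟪x.val, w⟫) inferInstance

theorem continuous_iff {α : Type*} [TopologicalSpace α] {g : α → WeakBall V ρ} :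
    Continuous g ↔ ∀ w : X, Continuous fun a => ⟪(g a).val, w⟫ := by
  rw [continuous_induced_rng, continuous_pi_iff]; rfl

theorem continuousOn_iff {α : Type*} [TopologicalSpace α] {g : α → WeakBall V ρ} {s : Set α} :
    ContinuousOn g s ↔ ∀ w : X, ContinuousOn (fun a => ⟪(g a).val, w⟫) s := by
  have h : IsInducing fun (x : WeakBall V ρ) (w : X) => ⟪x.val, w⟫ := ⟨rfl⟩
  rw [h.continuousOn_iff, continuousOn_pi]
  rfl

theorem continuous_inner (w : X) : Continuous fun x : WeakBall V ρ => ⟪x.val, w⟫ :=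
  continuous_iff.1 continuous_id w

theorem continuous_neg : Continuous fun x : WeakBall V ρ => -x :=
  continuous_iff.2 fun w => by
    simp only [val_neg, inner_neg_left]; exact (continuous_inner w).neg

theorem weakConv {x : ℕ → WeakBall V ρ} {y : WeakBall V ρ} (h : Tendsto x atTop (𝓝 y)) :
    WeakConv (fun n => (x n).val) y.val := fun w =>
  ((continuous_inner w).tendsto y).comp h

variable [CompleteSpace X]

/-- The Riesz embedding into the weak dual. -/
def toWeakDual (x : WeakBall V ρ) : WeakDual ℝ X :=
  StrongDual.toWeakDual (InnerProductSpace.toDual ℝ X x.val)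

theorem toWeakDual_apply (x : WeakBall V ρ) (w : X) : x.toWeakDual w = ⟪x.val, w⟫ := rfl

theorem isEmbedding_toWeakDual :
    IsEmbedding (toWeakDual : WeakBall V ρ → WeakDual ℝ X) := by
  refine ⟨⟨?_⟩, fun x y h => val_injective (ext_inner_right ℝ fun w => ?_)⟩
  · exact (induced_compose (f := toWeakDual) (g := fun (l : WeakDual ℝ X) (w : X) => l w)).symm
  · rw [← toWeakDual_apply, h, toWeakDual_apply]

theorem range_toWeakDual (hV : IsClosed (V : Set X)) :
    range (toWeakDual : WeakBall V ρ → WeakDual ℝ X) =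
      WeakDual.toStrongDual ⁻¹' closedBall 0 ρ ∩ {l | ∀ v ∈ Vᗮ, l v = 0} := by
  have : CompleteSpace V := hV.completeSpace_coe
  ext l
  constructor
  · rintro ⟨x, rfl⟩
    refine ⟨?_, fun v hv => ?_⟩
    · rw [mem_preimage, mem_closedBall_zero_iff]
      exact ((InnerProductSpace.toDual ℝ X).norm_map x.val).le.trans x.norm_val_le
    · rw [toWeakDual_apply]
      exact (Submodule.mem_orthogonal V v).1 hv _ x.val_mem
  · rintro ⟨h1, h2⟩
    set u := (InnerProductSpace.toDual ℝ X).symm (WeakDual.toStrongDual l) with hu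
    have hl : ∀ w, ⟪u, w⟫ = l w := fun w => by
      rw [hu, InnerProductSpace.toDual_symm_apply]; rfl
    have hnorm : ‖u‖ ≤ ρ := by
      rw [hu, LinearIsometryEquiv.norm_map]
      exact mem_closedBall_zero_iff.1 h1
    have hmem : u ∈ V := by
      rw [← V.orthogonal_orthogonal, Submodule.mem_orthogonal']
      intro v hv
      rw [hl, h2 v hv]
    exact ⟨⟨u, hmem, hnorm⟩, DFunLike.ext _ _ hl⟩

theorem isCompact_range_toWeakDual (hV : IsClosed (V : Set X)) :
    IsCompact (range (toWeakDual : WeakBall V ρ → WeakDual ℝ X)) := by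
  rw [range_toWeakDual hV]
  refine (WeakDual.isCompact_closedBall 0 ρ).inter_right ?_
  simp only [ofPred_forall]
  exact isClosed_iInter fun v => isClosed_iInter fun _ =>
    isClosed_eq (WeakDual.eval_continuous v) continuous_const

theorem compactSpace (hV : IsClosed (V : Set X)) : CompactSpace (WeakBall V ρ) := by
  rw [← isCompact_univ_iff, isEmbedding_toWeakDual.isCompact_iff, image_univ]
  exact isCompact_range_toWeakDual hV

theorem metrizableSpace [TopologicalSpace.SeparableSpace X] (hV : IsClosed (V : Set X)) :
    TopologicalSpace.MetrizableSpace (WeakBall V ρ) := by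
  have := WeakDual.metrizable_of_isCompact ℝ X _
    (isCompact_range_toWeakDual (ρ := ρ) hV)
  exact isEmbedding_toWeakDual.toHomeomorph.isEmbedding.metrizableSpace

end WeakBall

namespace FountainSetup

variable {X : Type*} [NormedAddCommGroup X] [InnerProductSpace ℝ X] [CompleteSpace X]
variable (S : FountainSetup X)

theorem inner_e_f (i j : ℕ) : ⟪S.e i, S.f j⟫ = 0 :=
  (Submodule.mem_orthogonal _ _).1 (S.f_mem j) _ (S.e_mem i)

theorem inner_f_e (i j : ℕ) : ⟪S.f i, S.e j⟫ = 0 := by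
  rw [real_inner_comm, S.inner_e_f]

theorem inner_f_f (i j : ℕ) : ⟪S.f i, S.f j⟫ = if i = j then 1 else 0 :=
  orthonormal_iff_ite.1 S.orth_f i j

theorem Q_eq_zero {u : X} (hu : u ∈ S.Y) : S.Q u = 0 := by
  have h1 : S.Q u ∈ S.Y := by
    rw [← S.P_add_Q u] at hu
    exact (S.Y.add_mem_iff_right (S.P_mem u)).1 hu
  exact inner_self_eq_zero.1 ((Submodule.mem_orthogonal _ _).1 (S.Q_mem u) _ h1)

theorem Q_eq_self {u : X} (hu : u ∈ S.Yᗮ) : S.Q u = u := by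
  have h1 : S.P u ∈ S.Yᗮ := by
    rw [← S.P_add_Q u] at hu
    exact (S.Yᗮ.add_mem_iff_left (S.Q_mem u)).1 hu
  have h2 : S.P u = 0 :=
    inner_self_eq_zero.1 ((Submodule.mem_orthogonal _ _).1 h1 _ (S.P_mem u))
  simpa [h2] using S.P_add_Q u

theorem inner_P (u : X) (j : ℕ) : ⟪S.P u, S.e j⟫ = ⟪u, S.e j⟫ := by
  conv_rhs => rw [← S.P_add_Q u, inner_add_left,
    (Submodule.mem_orthogonal' _ _).1 (S.Q_mem u) _ (S.e_mem j), add_zero]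

theorem f_mem_Yk {i k : ℕ} (h : i ≤ k) : S.f i ∈ S.Yk k :=
  Submodule.mem_sup_right (Submodule.subset_span ⟨i, h, rfl⟩)

theorem e_mem_Yk (i k : ℕ) : S.e i ∈ S.Yk k := Submodule.mem_sup_left (S.e_mem i)

theorem f_mem_Zk {i k : ℕ} (h : k ≤ i) : S.f i ∈ S.Zk k :=
  Submodule.le_topologicalClosure _ (Submodule.subset_span ⟨i, h, rfl⟩)

theorem mem_Yk_iff {k : ℕ} {u : X} :
    u ∈ S.Yk k ↔ S.Q u = ∑ i ∈ Finset.range (k + 1), ⟪u, S.f i⟫ • S.f i := by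
  constructor
  · intro hu
    obtain ⟨y, hy, z, hz, rfl⟩ := Submodule.mem_sup.1 hu
    have hyf : ∀ i, ⟪y, S.f i⟫ = 0 := fun i =>
      (Submodule.mem_orthogonal _ _).1 (S.f_mem i) _ hy
    simp only [map_add, S.Q_eq_zero hy, inner_add_left, hyf, zero_add]
    clear hu
    induction hz using Submodule.span_induction with
    | mem x hx =>
      obtain ⟨j, hj, rfl⟩ := hx
      have : j < k + 1 := Nat.lt_succ_of_le hj
      simp [S.Q_eq_self (S.f_mem j), S.inner_f_f, this]
    | zero => simp
    | add x y _ _ hx hy =>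
      simp only [map_add, inner_add_left, add_smul, Finset.sum_add_distrib]
      rw [hx, hy]
    | smul a x _ hx =>
      simp only [map_smul, inner_smul_left, mul_smul, ← Finset.smul_sum]
      rw [hx]
      rfl
  · intro h
    rw [← S.P_add_Q u, h]
    exact Submodule.add_mem _ (Submodule.mem_sup_left (S.P_mem u)) (Submodule.sum_mem _
      fun i hi => Submodule.smul_mem _ _ (S.f_mem_Yk (Finset.mem_range_succ_iff.1 hi)))

theorem isClosed_Yk (k : ℕ) : IsClosed (S.Yk k : Set X) := by
  have : (S.Yk k : Set X) =
      {u | S.Q u = ∑ i ∈ Finset.range (k + 1), ⟪u, S.f i⟫ • S.f i} := by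
    ext u; exact S.mem_Yk_iff
  rw [this]
  exact isClosed_eq (by fun_prop) (by fun_prop)

theorem inner_f_of_mem_Yk {k j : ℕ} {u : X} (hu : u ∈ S.Yk k) (hj : k < j) :
    ⟪S.f j, u⟫ = 0 := by
  rw [← S.P_add_Q u, S.mem_Yk_iff.1 hu, inner_add_right,
    (Submodule.mem_orthogonal' _ _).1 (S.f_mem j) _ (S.P_mem u), inner_sum, zero_add]
  refine Finset.sum_eq_zero fun i hi => ?_
  have : j ≠ i := by have := Finset.mem_range.1 hi; omega
  simp [inner_smul_right, S.inner_f_f, this]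

/-- On `Y_k` the orthogonal projection onto `Z_k` is the projection onto `f_k`. -/
theorem sub_mem_Zk_orthogonal {k : ℕ} {u : X} (hu : u ∈ S.Yk k) :
    u - ⟪u, S.f k⟫ • S.f k ∈ (S.Zk k)ᗮ := by
  rw [Zk, Submodule.orthogonal_closure, Submodule.mem_orthogonal]
  intro z hz
  induction hz using Submodule.span_induction with
  | mem x hx =>
    obtain ⟨j, hj, rfl⟩ := hx
    rcases (show k ≤ j from hj).eq_or_lt with rfl | hlt
    · simp [inner_sub_right, inner_smul_right, S.orth_f.1 k, real_inner_comm]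
    · simp [inner_sub_right, inner_smul_right, S.inner_f_f, hlt.ne',
        S.inner_f_of_mem_Yk hu hlt]
  | zero => simp
  | add x y _ _ hx hy => rw [inner_add_left, hx, hy, add_zero]
  | smul a x _ hx => rw [inner_smul_left, hx, mul_zero]

/-- A nested sequence of finite-dimensional spaces exhausting `X`. -/
def finSpan (k m : ℕ) : Submodule ℝ X :=
  Submodule.span ℝ (S.e '' Iio m ∪ S.f '' Iio (k + m))

theorem finSpan_mono (k : ℕ) : Monotone (S.finSpan k) := fun _ _ h =>
  Submodule.span_mono (union_subset_union (image_mono (Iio_subset_Iio h))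
    (image_mono (Iio_subset_Iio (Nat.add_le_add_left h k))))

theorem exists_mem_finSpan_norm_lt (k : ℕ) (u : X) {η : ℝ} (hη : 0 < η) :
    ∃ m, ∃ w ∈ S.finSpan k m, ‖w - u‖ < η := by
  have hdir : Directed (· ≤ ·) (S.finSpan k) := (S.finSpan_mono k).directed_le
  have he : S.Y ≤ (⨆ m, S.finSpan k m).topologicalClosure := by
    rw [← S.span_e]
    refine Submodule.topologicalClosure_mono (Submodule.span_le.2 ?_)
    rintro _ ⟨i, rfl⟩
    exact Submodule.mem_iSup_of_mem (i + 1)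
      (Submodule.subset_span (Or.inl ⟨i, Nat.lt_succ_self i, rfl⟩))
  have hf : S.Yᗮ ≤ (⨆ m, S.finSpan k m).topologicalClosure := by
    rw [← S.span_f]
    refine Submodule.topologicalClosure_mono (Submodule.span_le.2 ?_)
    rintro _ ⟨i, rfl⟩
    exact Submodule.mem_iSup_of_mem (i + 1)
      (Submodule.subset_span (Or.inr ⟨i, show i < k + (i + 1) by omega, rfl⟩))
  have hu : u ∈ closure ((⨆ m, S.finSpan k m : Submodule ℝ X) : Set X) := by
    rw [← Submodule.topologicalClosure_coe]
    rw [← S.P_add_Q u]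
    exact Submodule.add_mem _ (he (S.P_mem u)) (hf (S.Q_mem u))
  obtain ⟨w, hw, hd⟩ := Metric.mem_closure_iff.1 hu η hη
  obtain ⟨m, hm⟩ := (Submodule.mem_iSup_of_directed _ hdir).1 hw
  exact ⟨m, w, hm, by rwa [dist_comm, dist_eq_norm] at hd⟩

theorem tauNorm_neg (u : X) : S.tauNorm (-u) = S.tauNorm u := by
  simp [tauNorm]

/-- Sequential continuity of the τ-norm with respect to weak convergence with strongly
convergent `Z`-component. -/
theorem tendsto_tauNorm {u : ℕ → X} {v : X} {C : ℝ} (hC : ∀ n, ‖u n‖ ≤ C)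
    (hu : WeakConv u v) (hQ : Tendsto (fun n => S.Q (u n)) atTop (𝓝 (S.Q v))) :
    Tendsto (fun n => S.tauNorm (u n)) atTop (𝓝 (S.tauNorm v)) := by
  refine Tendsto.max ?_ hQ.norm
  simp only [S.inner_P]
  refine tendsto_tsum_of_dominated_convergence
    (bound := fun j => (1 / 2 : ℝ) ^ (j + 1) * C) ?_ ?_ ?_
  · exact ((summable_nat_add_iff 1).2
      (summable_geometric_of_lt_one (by norm_num) (by norm_num))).mul_right C
  · exact fun j => (hu (S.e j)).abs.const_mul _
  · refine Eventually.of_forall fun n j => ?_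
    rw [Real.norm_eq_abs, abs_mul, abs_of_pos (by positivity), abs_abs]
    gcongr
    refine (abs_real_inner_le_norm _ _).trans ?_
    rw [S.orth_e.1 j, mul_one]
    exact hC n

end FountainSetup

namespace FountainSetup

variable {X : Type*} [NormedAddCommGroup X] [InnerProductSpace ℝ X] [CompleteSpace X]
variable (S : FountainSetup X)

/-- Coordinates of pairs of vectors in finite-dimensional parts of `Y_k` and `Z_k`. -/
abbrev GalerkinSpace (k m : ℕ) : Type :=
  (Fin (k + 1) → ℝ) × (Fin m → ℝ) × (Fin m → ℝ)

/-- A finite-dimensional Galerkin approximation of the linking of `Y_k` and `Z_k`. -/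
theorem exists_galerkin_solution {k m : ℕ} (hm : 0 < m) {ρ r : ℝ} (hρ : 0 < ρ) (hr : 0 < r)
    (c : C(WeakBall (S.Yk k) ρ, X)) (hodd : ∀ x, c (-x) = -c x) :
    ∃ (x : WeakBall (S.Yk k) ρ) (z : X), z ∈ S.Zk k ∧ ‖z‖ ≤ r ∧ (‖x.val‖ = ρ ∨ ‖z‖ = r) ∧
      z - x.val ∈ S.finSpan k m ∧ ∀ w ∈ S.finSpan k m, ⟪w, x.val + c x - z⟫ = 0 := by
  let A : GalerkinSpace k m → X := fun p =>
    ∑ i : Fin (k + 1), p.1 i • S.f i + ∑ j : Fin m, p.2.1 j • S.e j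
  let B : GalerkinSpace k m → X := fun p => ∑ j : Fin m, p.2.2 j • S.f (k + j)
  let N : GalerkinSpace k m → ℝ := fun p => max (‖A p‖ / ρ) (‖B p‖ / r)
  have hAc : Continuous A := by fun_prop
  have hBc : Continuous B := by fun_prop
  have hNc : Continuous N := by fun_prop
  have hAneg : ∀ p, A (-p) = -A p := fun p => by simp [A, add_comm]
  have hBneg : ∀ p, B (-p) = -B p := fun p => by simp [B]
  have hNneg : ∀ p, N (-p) = N p := fun p => by simp only [N, hAneg, hBneg, norm_neg]
  have hAmem : ∀ p, A p ∈ S.Yk k := fun p => Submodule.add_mem _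
    (Submodule.sum_mem _ fun i _ =>
      Submodule.smul_mem _ _ (S.f_mem_Yk (Nat.lt_succ_iff.1 i.2)))
    (Submodule.sum_mem _ fun i _ => Submodule.smul_mem _ _ (S.e_mem_Yk _ _))
  have hBmem : ∀ p, B p ∈ S.Zk k := fun p => Submodule.sum_mem _ fun i _ =>
    Submodule.smul_mem _ _ (S.f_mem_Zk (Nat.le_add_right k i))
  have hf : ∀ i < k + m, S.f i ∈ S.finSpan k m := fun i hi =>
    Submodule.subset_span (Or.inr ⟨i, hi, rfl⟩)
  have he : ∀ i < m, S.e i ∈ S.finSpan k m := fun i hi =>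
    Submodule.subset_span (Or.inl ⟨i, hi, rfl⟩)
  have hAfin : ∀ p, A p ∈ S.finSpan k m := fun p => Submodule.add_mem _
    (Submodule.sum_mem _ fun i _ => Submodule.smul_mem _ _ (hf _ (by omega)))
    (Submodule.sum_mem _ fun i _ => Submodule.smul_mem _ _ (he _ i.2))
  have hBfin : ∀ p, B p ∈ S.finSpan k m := fun p => Submodule.sum_mem _ fun i _ =>
    Submodule.smul_mem _ _ (hf _ (by omega))
  have hN0 : ∀ p, 0 ≤ N p := fun p => le_max_of_le_left (by positivity)
  have hAN : ∀ p, ‖A p‖ ≤ ρ * N p := fun p => by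
    rw [mul_comm, ← div_le_iff₀ hρ]; exact le_max_left _ _
  have hBN : ∀ p, ‖B p‖ ≤ r * N p := fun p => by
    rw [mul_comm, ← div_le_iff₀ hr]; exact le_max_right _ _
  have hNpos : ∀ p, p ≠ 0 → 0 < N p := by
    intro p hp
    refine (hN0 p).lt_of_ne fun h0 => hp ?_
    have hA : A p = 0 := norm_le_zero_iff.1 (by simpa [← h0] using hAN p)
    have hB : B p = 0 := norm_le_zero_iff.1 (by simpa [← h0] using hBN p)
    refine Prod.ext (funext fun i => ?_) (Prod.ext (funext fun j => ?_) (funext fun j => ?_))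
    · have := congrArg (fun u => ⟪S.f i, u⟫) hA
      simpa [A, inner_add_right, inner_sum, inner_smul_right, S.inner_f_f, S.inner_f_e,
        Fin.val_inj] using this
    · have := congrArg (fun u => ⟪S.e j, u⟫) hA
      simpa [A, inner_add_right, inner_sum, inner_smul_right, S.inner_e_f,
        orthonormal_iff_ite.1 S.orth_e, Fin.val_inj] using this
    · have := congrArg (fun u => ⟪S.f (k + j), u⟫) hB
      simpa [B, inner_sum, inner_smul_right, S.inner_f_f, Fin.val_inj] using this
  have hscale : ∀ p, ∀ {u : X} {t : ℝ}, 0 ≤ t → ‖u‖ ≤ t * N p → ‖(N p)⁻¹ • u‖ ≤ t := by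
    intro p u t ht hu
    rw [norm_smul, norm_inv, Real.norm_of_nonneg (hN0 p), inv_mul_eq_div]
    exact div_le_of_le_mul₀ (hN0 p) ht hu
  let g : GalerkinSpace k m → WeakBall (S.Yk k) ρ := fun p =>
    ⟨(N p)⁻¹ • A p, Submodule.smul_mem _ _ (hAmem p), hscale p hρ.le (hAN p)⟩
  have hgval : ∀ p, (g p).val = (N p)⁻¹ • A p := fun p => rfl
  have hNinv : ContinuousOn (fun p => (N p)⁻¹) {0}ᶜ :=
    hNc.continuousOn.inv₀ fun p hp => (hNpos p hp).ne'
  have hgc : ContinuousOn g {0}ᶜ := WeakBall.continuousOn_iff.2 fun w => by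
    simp only [hgval]
    exact (hNinv.smul hAc.continuousOn).inner continuousOn_const
  have hgneg : ∀ p, g (-p) = -g p := fun p => WeakBall.val_injective (by
    rw [WeakBall.val_neg, hgval, hgval, hNneg, hAneg, smul_neg])
  let D : GalerkinSpace k m → X := fun p => (g p).val + c (g p) - (N p)⁻¹ • B p
  have hDc : ContinuousOn D {0}ᶜ := by
    refine ContinuousOn.sub (ContinuousOn.add ?_ ?_) (hNinv.smul hBc.continuousOn)
    · exact hNinv.smul hAc.continuousOn
    · exact c.continuous.comp_continuousOn hgc
  have hDneg : ∀ p, D (-p) = -D p := fun p => by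
    simp only [D, hgneg, hodd, WeakBall.val_neg, hNneg, hBneg, smul_neg]
    abel
  let Φ : GalerkinSpace k m → (Fin m → ℝ) × (Fin (k + m) → ℝ) := fun p =>
    (fun j => ⟪S.e j, D p⟫, fun j => ⟪S.f j, D p⟫)
  have hΦc : ContinuousOn Φ {0}ᶜ := by
    refine ContinuousOn.prodMk (continuousOn_pi.2 fun j => ?_) (continuousOn_pi.2 fun j => ?_)
    · exact continuousOn_const.inner hDc
    · exact continuousOn_const.inner hDc
  obtain ⟨p, hp, hΦ⟩ := borsuk_ulam (E := GalerkinSpace k m) (f := Φ) (by simp; omega)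
    hΦc fun p _ => by
    simp only [Φ, hDneg, inner_neg_right]; rfl
  refine ⟨g p, (N p)⁻¹ • B p, Submodule.smul_mem _ _ (hBmem p), hscale p hr.le (hBN p), ?_,
    Submodule.sub_mem _ (Submodule.smul_mem _ _ (hBfin p))
      (Submodule.smul_mem _ _ (hAfin p)), ?_⟩
  · have hNp := hNpos p hp
    have hn : ∀ {u : X} {t : ℝ}, 0 < t → N p = ‖u‖ / t → ‖(N p)⁻¹ • u‖ = t := by
      intro u t ht h
      rw [norm_smul, norm_inv, Real.norm_of_nonneg hNp.le, inv_mul_eq_iff_eq_mul₀ hNp.ne', h,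
        div_mul_cancel₀ _ ht.ne']
    rcases max_choice (‖A p‖ / ρ) (‖B p‖ / r) with h | h
    · exact Or.inl (hn hρ h)
    · exact Or.inr (hn hr h)
  · intro w hw
    change ⟪w, D p⟫ = 0
    induction hw using Submodule.span_induction with
    | mem x hx =>
      rcases hx with ⟨j, hj, rfl⟩ | ⟨j, hj, rfl⟩
      · exact congrFun (congrArg Prod.fst hΦ) ⟨j, hj⟩
      · exact congrFun (congrArg Prod.snd hΦ) ⟨j, hj⟩
    | zero => simp
    | add x y _ _ hx hy => rw [inner_add_left, hx, hy, add_zero]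
    | smul a x _ hx => rw [inner_smul_left, hx, mul_zero]

theorem exists_add_mem_Zk {k : ℕ} {ρ r : ℝ} (hρ : 0 < ρ) (hr : 0 < r)
    (c : C(WeakBall (S.Yk k) ρ, X)) (hodd : ∀ x, c (-x) = -c x) :
    ∃ x : WeakBall (S.Yk k) ρ, x.val + c x ∈ S.Zk k ∧ ‖x.val + c x‖ ≤ r ∧
      (‖x.val‖ = ρ ∨ ‖x.val + c x‖ = r) := by
  have := S.separable
  have := WeakBall.compactSpace (ρ := ρ) (S.isClosed_Yk k)
  have := WeakBall.metrizableSpace (ρ := ρ) (S.isClosed_Yk k)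
  have hZ : CompleteSpace (S.Zk k) :=
    (Submodule.isClosed_topologicalClosure _).completeSpace_coe
  choose x z hz hzr hor hfin horth using fun m : ℕ =>
    S.exists_galerkin_solution m.succ_pos hρ hr c hodd
  obtain ⟨y, ψ, hψ, hy⟩ := CompactSpace.tendsto_subseq x
  have hc : Tendsto (fun n => c (x (ψ n))) atTop (𝓝 (c y)) := (c.continuous.tendsto y).comp hy
  have hweak : WeakConv (fun n => (x (ψ n)).val) y.val := WeakBall.weakConv hy
  have hpc : Tendsto (fun n => z (ψ n) - (x (ψ n)).val) atTop (𝓝 (c y)) := by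
    rw [Metric.tendsto_atTop]
    intro η hη
    obtain ⟨m, w, hw, hwη⟩ := S.exists_mem_finSpan_norm_lt k (c y) (by positivity : 0 < η / 3)
    obtain ⟨n₀, hn₀⟩ := Metric.tendsto_atTop.1 hc (η / 3) (by positivity)
    refine ⟨max m n₀, fun n hn => ?_⟩
    have hd := hn₀ n (le_of_max_le_right hn)
    rw [dist_eq_norm] at hd ⊢
    have hw' : w ∈ S.finSpan k (ψ n + 1) := S.finSpan_mono k
      ((le_of_max_le_left hn).trans ((hψ.id_le n).trans (Nat.le_succ _))) hw
    set p := z (ψ n) - (x (ψ n)).val with hp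
    set d := c (x (ψ n)) with hd'
    have ho : ⟪p - w, d - p⟫ = 0 := by
      have := horth (ψ n) (p - w) (Submodule.sub_mem _ (hfin _) hw')
      rwa [show (x (ψ n)).val + c (x (ψ n)) - z (ψ n) = d - p by rw [hp, hd']; abel] at this
    have hle : ‖d - p‖ ≤ ‖d - w‖ := by
      have h := norm_add_sq_eq_norm_sq_add_norm_sq_of_inner_eq_zero _ _ ho
      rw [show p - w + (d - p) = d - w by abel] at h
      nlinarith [norm_nonneg (p - w), norm_nonneg (d - p), norm_nonneg (d - w)]
    have h1 : ‖p - c y‖ ≤ ‖d - p‖ + ‖d - c y‖ := by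
      rw [show p - c y = (d - c y) - (d - p) by abel, add_comm]
      exact norm_sub_le _ _
    have h2 : ‖d - w‖ ≤ ‖d - c y‖ + ‖w - c y‖ := by
      rw [show d - w = (d - c y) - (w - c y) by abel]
      exact norm_sub_le _ _
    linarith
  have hzeq : ∀ n, z n = (S.Zk k).starProjection (z n - (x n).val) +
      ⟪(x n).val, S.f k⟫ • S.f k := by
    intro n
    have h1 := (Submodule.starProjection_apply_eq_zero_iff _).2
      (S.sub_mem_Zk_orthogonal (x n).val_mem)
    rw [map_sub, map_smul, Submodule.starProjection_eq_self_iff.2 (S.f_mem_Zk le_rfl),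
      sub_eq_zero] at h1
    rw [map_sub, h1, Submodule.starProjection_eq_self_iff.2 (hz n), sub_add_cancel]
  have hzc : ∃ z₀, Tendsto (fun n => z (ψ n)) atTop (𝓝 z₀) := by
    refine ⟨_, Tendsto.congr (fun n => (hzeq (ψ n)).symm) (Tendsto.add
      (((S.Zk k).starProjection.continuous.tendsto _).comp hpc)
      ((hweak (S.f k)).smul_const (S.f k)))⟩
  obtain ⟨z₀, hz₀⟩ := hzc
  have hxc : Tendsto (fun n => (x (ψ n)).val) atTop (𝓝 (z₀ - c y)) :=
    (hz₀.sub hpc).congr fun n => sub_sub_cancel _ _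
  have hyz : y.val = z₀ - c y := by
    refine ext_inner_right ℝ fun w => tendsto_nhds_unique (hweak w) ?_
    exact hxc.inner tendsto_const_nhds
  have hz₀' : y.val + c y = z₀ := by rw [hyz, sub_add_cancel]
  rw [← hyz] at hxc
  refine ⟨y, ?_⟩
  rw [hz₀']
  refine ⟨(Submodule.isClosed_topologicalClosure _).mem_of_tendsto hz₀
    (Eventually.of_forall fun n => hz _), le_of_tendsto hz₀.norm
    (Eventually.of_forall fun n => hzr _), ?_⟩
  have hcl : IsClosed {q : ℝ × ℝ | q.1 = ρ ∨ q.2 = r} :=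
    (isClosed_eq continuous_fst continuous_const).union
      (isClosed_eq continuous_snd continuous_const)
  exact hcl.mem_of_tendsto (hxc.norm.prodMk_nhds hz₀.norm) (Eventually.of_forall fun n => hor _)

end FountainSetup

/-- **Ekeland's variational principle.** -/
theorem exists_ekeland_point {M : Type*} [MetricSpace M] [CompleteSpace M] [Nonempty M]
    {F : M → ℝ} (hF : LowerSemicontinuous F) (hb : BddBelow (range F)) {ε : ℝ} (hε : 0 < ε) :
    ∃ x, ∀ y, F y + ε * dist y x ≤ F x → y = x := by
  let s : M → Set M := fun x => {y | F y + ε * dist y x ≤ F x}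
  have hself : ∀ x, x ∈ s x := fun x => by simp [s]
  have htrans : ∀ {x y z}, z ∈ s y → y ∈ s x → z ∈ s x := by
    intro x y z hz hy
    simp only [s, mem_ofPred_eq] at *
    nlinarith [dist_triangle z y x]
  have hclosed : ∀ x, IsClosed (s x) := fun x =>
    (hF.add (Continuous.lowerSemicontinuous (by fun_prop))).isClosed_preimage (F x)
  have hstep : ∀ (n : ℕ) (x : M), ∃ y ∈ s x, ∀ z ∈ s x, F y ≤ F z + (1 / 2) ^ n := by
    intro n x
    have hbx : BddBelow (F '' s x) := hb.mono (image_subset_range _ _)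
    obtain ⟨_, ⟨y, hy, rfl⟩, hlt⟩ := exists_lt_of_csInf_lt
      (Set.Nonempty.image F ⟨x, hself x⟩)
      (lt_add_of_pos_right (sInf (F '' s x)) (by positivity : (0 : ℝ) < (1 / 2) ^ n))
    exact ⟨y, hy, fun z hz => hlt.le.trans (by gcongr; exact csInf_le hbx ⟨z, hz, rfl⟩)⟩
  choose g hg hgmin using hstep
  let x : ℕ → M := fun n => Nat.rec (Classical.arbitrary M) g n
  have hx : ∀ n, x (n + 1) = g n (x n) := fun n => rfl
  have hmono : ∀ n m, n ≤ m → x m ∈ s (x n) := by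
    intro n m h
    induction m, h using Nat.le_induction with
    | base => exact hself _
    | succ m _ ih => exact htrans (by rw [hx]; exact hg _ _) ih
  have hdist : ∀ n, ∀ y ∈ s (x (n + 1)), dist y (x (n + 1)) ≤ (1 / 2) ^ n / ε := by
    intro n y hy
    have h1 := hgmin n (x n) y (htrans hy (hmono _ _ n.le_succ))
    rw [← hx] at h1
    rw [le_div_iff₀ hε]
    simp only [s, mem_ofPred_eq] at hy
    linarith
  have hlim : Tendsto (fun n : ℕ => (1 / 2 : ℝ) ^ n / ε) atTop (𝓝 0) := by
    simpa using (tendsto_pow_atTop_nhds_zero_of_lt_one (r := (1 / 2 : ℝ)) (by norm_num)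
      (by norm_num)).div_const ε
  have hcauchy : CauchySeq fun n => x (n + 1) := by
    refine cauchySeq_of_le_tendsto_0' _ (fun n m h => ?_) hlim
    rw [dist_comm]
    exact hdist n _ (hmono _ _ (Nat.succ_le_succ h))
  obtain ⟨a, ha⟩ := cauchySeq_tendsto_of_complete hcauchy
  have hmem : ∀ n, a ∈ s (x (n + 1)) := fun n => (hclosed _).mem_of_tendsto ha
    ((eventually_ge_atTop n).mono fun m hm => hmono _ _ (Nat.succ_le_succ hm))
  refine ⟨a, fun y hy => ?_⟩
  refine tendsto_nhds_unique (f := fun n => x (n + 1)) (l := atTop) ?_ ha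
  rw [tendsto_iff_dist_tendsto_zero]
  refine squeeze_zero (fun _ => dist_nonneg) (fun n => ?_) hlim
  rw [dist_comm]
  exact hdist n y (htrans hy (hmem n))

namespace WeakBall

variable {X : Type*} [NormedAddCommGroup X] [InnerProductSpace ℝ X]

theorem weakConv_deformation {V : Submodule ℝ X} {ρ : ℝ} (c : C(WeakBall V ρ, X))
    {x : ℕ → WeakBall V ρ} {x₀ : WeakBall V ρ} (hx : Tendsto x atTop (𝓝 x₀))
    {y : ℕ → X} (hy : Tendsto y atTop (𝓝 0)) :
    WeakConv (fun n => (x n).val + c (x n) + y n) (x₀.val + c x₀) := by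
  intro w
  have h1 := WeakBall.weakConv hx w
  have h2 : Tendsto (fun n => ⟪c (x n), w⟫) atTop (𝓝 ⟪c x₀, w⟫) :=
    ((c.continuous.tendsto x₀).comp hx).inner tendsto_const_nhds
  have h3 : Tendsto (fun n => ⟪y n, w⟫) atTop (𝓝 ⟪(0 : X), w⟫) := hy.inner tendsto_const_nhds
  simpa [inner_add_left] using (h1.add h2).add h3

theorem tendsto_deriv_deformation {φ' : X → X →L[ℝ] ℝ} (hwsc : WeaklySeqContDeriv φ')
    {V : Submodule ℝ X} {ρ : ℝ} [FirstCountableTopology (WeakBall V ρ)]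
    (c : C(WeakBall V ρ, X)) (x : WeakBall V ρ) (w : X) :
    Tendsto (fun p : WeakBall V ρ × X => φ' (p.1.val + c p.1 + p.2) w) (𝓝 (x, 0))
      (𝓝 (φ' (x.val + c x) w)) :=
  tendsto_of_seq_tendsto fun p hp => by
    rw [nhds_prod_eq, tendsto_prod_iff'] at hp
    exact hwsc _ _ (weakConv_deformation c hp.1 hp.2) w

end WeakBall

namespace FountainSetup

variable {X : Type*} [NormedAddCommGroup X] [InnerProductSpace ℝ X] [CompleteSpace X]
variable (S : FountainSetup X)

theorem continuous_tauNorm_deformation {k : ℕ} {ρ : ℝ}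
    [FirstCountableTopology (WeakBall (S.Yk k) ρ)] [CompactSpace (WeakBall (S.Yk k) ρ)]
    (c : C(WeakBall (S.Yk k) ρ, X)) :
    Continuous fun x : WeakBall (S.Yk k) ρ => S.tauNorm (x.val + c x) := by
  refine continuous_iff_seqContinuous.2 fun x x₀ hx => ?_
  refine S.tendsto_tauNorm (C := ρ + ‖c‖) (fun n => norm_add_le_of_le (x n).norm_val_le
    (c.norm_coe_le_norm _)) ?_ ?_
  · simpa using WeakBall.weakConv_deformation c hx tendsto_const_nhds
  · have hc : Continuous fun x : WeakBall (S.Yk k) ρ => S.Q (x.val + c x) := by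
      simp only [map_add, S.mem_Yk_iff.1 (WeakBall.val_mem _)]
      refine Continuous.add (continuous_finsetSum _ fun i _ =>
        (WeakBall.continuous_inner _).smul continuous_const) ?_
      exact S.Q.continuous.comp c.continuous
    exact (hc.tendsto x₀).comp hx

/-- A descent field along the deformation `x ↦ x + c x`. -/
theorem exists_descent_field {φ' : X → X →L[ℝ] ℝ} (hwsc : WeaklySeqContDeriv φ')
    (hφ'odd : ∀ u, φ' (-u) = -φ' u) {k : ℕ} {ρ δ ε : ℝ} (hδ : 0 < δ) (hε : 0 < ε)
    (c : C(WeakBall (S.Yk k) ρ, X)) (hodd : ∀ x, c (-x) = -c x)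
    (hgrad : ∀ x : WeakBall (S.Yk k) ρ, δ / 2 ≤ S.tauNorm (x.val + c x) →
      ε < ‖φ' (x.val + c x)‖) :
    ∃ s > 0, ∃ χ : C(WeakBall (S.Yk k) ρ, X), (∀ x, χ (-x) = -χ x) ∧ (∀ x, ‖χ x‖ ≤ 1) ∧
      ∀ x, ∀ y : X, ‖y‖ ≤ s → φ' (x.val + c x + y) (χ x) ≤ 0 ∧
        (δ ≤ S.tauNorm (x.val + c x) → φ' (x.val + c x + y) (χ x) ≤ -ε) := by
  have := S.separable
  have := WeakBall.compactSpace (ρ := ρ) (S.isClosed_Yk k)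
  have := WeakBall.metrizableSpace (ρ := ρ) (S.isClosed_Yk k)
  have hτ := S.continuous_tauNorm_deformation c
  let G : WeakBall (S.Yk k) ρ → X → X → Prop := fun x y w =>
    φ' (x.val + c x + y) w ≤ 0 ∧ (δ ≤ S.tauNorm (x.val + c x) → φ' (x.val + c x + y) w ≤ -ε)
  have hloc : ∀ x, ∃ s > 0, ∃ w : X, ‖w‖ ≤ 1 ∧ ∀ᶠ x' in 𝓝 x, ∀ y, ‖y‖ ≤ s → G x' y w := by
    intro x
    by_cases hx : δ / 2 ≤ S.tauNorm (x.val + c x)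
    · obtain ⟨w, hw1, hw⟩ :=
        ContinuousLinearMap.exists_lt_apply_of_lt_opNorm _ (hgrad x hx)
      obtain ⟨w, hw1, hw⟩ : ∃ w, ‖w‖ ≤ 1 ∧ φ' (x.val + c x) w < -ε := by
        rcases lt_abs.1 hw with h | h
        · exact ⟨-w, by rw [norm_neg]; exact hw1.le, by rw [map_neg]; exact neg_lt_neg h⟩
        · exact ⟨w, hw1.le, lt_neg_of_lt_neg h⟩
      have hev := (WeakBall.tendsto_deriv_deformation hwsc c x w).eventually_lt_const hw
      rw [nhds_prod_eq] at hev
      obtain ⟨U, hU, W, hW, h⟩ := eventually_prod_iff.1 hev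
      obtain ⟨s, hs, hsW⟩ := Metric.nhds_basis_closedBall.eventually_iff.1 hW
      refine ⟨s, hs, w, hw1, hU.mono fun x' hx' y hy => ?_⟩
      have := h hx' (hsW (mem_closedBall_zero_iff.2 hy))
      exact ⟨by linarith, fun _ => this.le⟩
    · refine ⟨1, one_pos, 0, by simp, ?_⟩
      filter_upwards [hτ.continuousAt.eventually_lt_const (by linarith : _ < δ)] with x' hx' y _
      exact ⟨by simp, fun h => absurd hx' h.not_gt⟩
  obtain ⟨s, hs, hunif⟩ : ∃ s > 0, ∀ x ∈ (univ : Set (WeakBall (S.Yk k) ρ)),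
      ∃ w : X, ‖w‖ ≤ 1 ∧ ∀ᶠ x' in 𝓝 x, ∀ y, ‖y‖ ≤ s → G x' y w := by
    refine isCompact_univ.induction_on (p := fun A => ∃ s > 0, ∀ x ∈ A,
      ∃ w : X, ‖w‖ ≤ 1 ∧ ∀ᶠ x' in 𝓝 x, ∀ y, ‖y‖ ≤ s → G x' y w) ?_ ?_ ?_ ?_
    · exact ⟨1, one_pos, fun x hx => hx.elim⟩
    · rintro A B hAB ⟨s, hs, h⟩
      exact ⟨s, hs, fun x hx => h x (hAB hx)⟩
    · rintro A B ⟨s, hs, h⟩ ⟨t, ht, h'⟩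
      refine ⟨min s t, lt_min hs ht, ?_⟩
      rintro x (hx | hx)
      · obtain ⟨w, hw, hG⟩ := h x hx
        exact ⟨w, hw, hG.mono fun x' hx' y hy => hx' y (hy.trans (min_le_left _ _))⟩
      · obtain ⟨w, hw, hG⟩ := h' x hx
        exact ⟨w, hw, hG.mono fun x' hx' y hy => hx' y (hy.trans (min_le_right _ _))⟩
    · intro x _
      obtain ⟨s, hs, w, hw, hG⟩ := hloc x
      exact ⟨_, mem_nhdsWithin_of_mem_nhds hG.eventually_nhds, s, hs, fun x' hx' => ⟨w, hw, hx'⟩⟩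
  obtain ⟨χ, hχ⟩ := exists_continuous_forall_mem_convex_of_local_const
    (t := fun x => {w : X | ‖w‖ ≤ 1 ∧ ∀ y, ‖y‖ ≤ s → G x y w})
    (fun x => by
      rintro w₁ ⟨hw₁, h₁⟩ w₂ ⟨hw₂, h₂⟩ a b ha hb hab
      refine ⟨?_, fun y hy => ⟨?_, fun hx => ?_⟩⟩
      · exact mem_closedBall_zero_iff.1 (convex_closedBall (0 : X) 1
          (mem_closedBall_zero_iff.2 hw₁) (mem_closedBall_zero_iff.2 hw₂) ha hb hab)
      · have e₁ := (h₁ y hy).1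
        have e₂ := (h₂ y hy).1
        simp only [map_add, map_smul, smul_eq_mul]
        nlinarith
      · have e₁ := (h₁ y hy).2 hx
        have e₂ := (h₂ y hy).2 hx
        simp only [map_add, map_smul, smul_eq_mul]
        nlinarith)
    (fun x => by
      obtain ⟨w, hw, hG⟩ := hunif x (mem_univ x)
      exact ⟨w, hG.mono fun x' hx' => ⟨hw, hx'⟩⟩)
  refine ⟨s, hs, ⟨fun x => (1 / 2 : ℝ) • (χ x - χ (-x)),
    (χ.continuous.sub (χ.continuous.comp WeakBall.continuous_neg)).const_smul _⟩, ?_, ?_, ?_⟩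
  · intro x
    simp only [ContinuousMap.coe_mk, WeakBall.neg_neg]
    rw [← smul_neg, neg_sub]
  · intro x
    simp only [ContinuousMap.coe_mk]
    rw [norm_smul, Real.norm_of_nonneg (by norm_num)]
    have := norm_sub_le (χ x) (χ (-x))
    linarith [(hχ x).1, (hχ (-x)).1]
  · intro x y hy
    simp only [ContinuousMap.coe_mk]
    have h₁ := (hχ x).2 y hy
    have h₂ := (hχ (-x)).2 (-y) (by rwa [norm_neg])
    have hv' : (-x).val + c (-x) = -(x.val + c x) := by
      rw [WeakBall.val_neg, hodd]; abel
    simp only [G, hv', ← neg_add, hφ'odd, S.tauNorm_neg, neg_apply] at h₁ h₂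
    simp only [map_smul, map_sub, smul_eq_mul]
    exact ⟨by linarith [h₁.1, h₂.1], fun h => by linarith [h₁.2 h, h₂.2 h]⟩

end FountainSetup

theorem neg_deriv_of_even {X : Type*} [NormedAddCommGroup X] [NormedSpace ℝ X] {φ : X → ℝ}
    {φ' : X → X →L[ℝ] ℝ} (hderiv : ∀ u, HasFDerivAt φ (φ' u) u) (heven : ∀ u, φ (-u) = φ u)
    (u : X) : φ' (-u) = -φ' u := by
  have h : HasFDerivAt (fun v => φ (-v)) ((φ' (-u)).comp (-ContinuousLinearMap.id ℝ X)) u :=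
    (hderiv (-u)).comp u (hasFDerivAt_id u).neg
  simp only [heven] at h
  rw [← h.unique (hderiv u)]
  ext w
  simp

namespace FountainSetup

variable {X : Type*} [NormedAddCommGroup X] [InnerProductSpace ℝ X] [CompleteSpace X]
variable (S : FountainSetup X)

/-- The fountain geometry forces an almost critical point of `φ`. -/
theorem exists_almost_critical {φ : X → ℝ} {φ' : X → X →L[ℝ] ℝ}
    (hderiv : ∀ u, HasFDerivAt φ (φ' u) u) (heven : ∀ u, φ (-u) = φ u)
    (hwsc : WeaklySeqContDeriv φ') {k : ℕ} {ρ r δ ε d a b t : ℝ} (hρ : 0 < ρ) (hr : 0 < r)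
    (hδ : 0 < δ) (hε : 0 < ε) (hd : ∀ u ∈ S.Yk k, ‖u‖ ≤ ρ → φ u ≤ d)
    (ha : ∀ u ∈ S.Yk k, ‖u‖ = ρ → φ u ≤ a) (ha' : ∀ u ∈ S.Zk k, ‖u‖ ≤ r → a < φ u)
    (hb : ∀ u ∈ S.Zk k, ‖u‖ = r → b ≤ φ u) (ht : ∀ u, S.tauNorm u < δ → φ u ≤ t)
    (htb : t < b) : ∃ u, φ u ≤ d ∧ δ / 2 ≤ S.tauNorm u ∧ ‖φ' u‖ ≤ ε := by
  by_contra! hgrad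
  have := S.separable
  have := WeakBall.compactSpace (ρ := ρ) (S.isClosed_Yk k)
  have := WeakBall.metrizableSpace (ρ := ρ) (S.isClosed_Yk k)
  have hφ : Continuous φ := continuous_iff_continuousAt.2 fun u => (hderiv u).continuousAt
  let Γ : Set C(WeakBall (S.Yk k) ρ, X) := {c | (∀ x, c (-x) = -c x) ∧
    (∀ x, φ (x.val + c x) ≤ d) ∧ ∀ x, ‖x.val‖ = ρ → φ (x.val + c x) ≤ a}
  have heval : ∀ x : WeakBall (S.Yk k) ρ,
      Continuous fun c : C(WeakBall (S.Yk k) ρ, X) => φ (x.val + c x) := fun x =>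
    hφ.comp (continuous_const.add (continuous_eval_const x))
  have hΓ : IsClosed Γ := by
    have h₁ : Γ = (⋂ x, {c | c (-x) = -c x}) ∩ ((⋂ x, {c | φ (x.val + c x) ≤ d}) ∩
        ⋂ x : WeakBall (S.Yk k) ρ, ⋂ _ : ‖x.val‖ = ρ, {c | φ (x.val + c x) ≤ a}) := by
      ext c
      simp [Γ]
    rw [h₁]
    exact (isClosed_iInter fun x => isClosed_eq
        (continuous_eval_const _) (continuous_eval_const _).neg).inter
      ((isClosed_iInter fun x => isClosed_le (heval x) continuous_const).inter
        (isClosed_iInter fun x => isClosed_iInter fun _ =>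
          isClosed_le (heval x) continuous_const))
  have hlink : ∀ c ∈ Γ, ∃ x : WeakBall (S.Yk k) ρ, b ≤ φ (x.val + c x) := by
    rintro c ⟨hodd, -, hca⟩
    obtain ⟨x, hxZ, hxr, hx | hx⟩ := S.exists_add_mem_Zk hρ hr c hodd
    · exact absurd (hca x hx) (ha' _ hxZ hxr).not_ge
    · exact ⟨x, hb _ hxZ hx⟩
  have : CompleteSpace Γ := hΓ.completeSpace_coe
  have : Nonempty Γ := ⟨⟨0, fun x => by simp, fun x => by
    simpa using hd _ x.val_mem x.norm_val_le, fun x hx => by simpa using ha _ x.val_mem hx⟩⟩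
  let Ψ : Γ → ℝ := fun c => ⨆ x : WeakBall (S.Yk k) ρ, φ (x.val + c.1 x)
  have hbdd : ∀ c : Γ, BddAbove (range fun x : WeakBall (S.Yk k) ρ => φ (x.val + c.1 x)) :=
    fun c => ⟨d, by rintro _ ⟨x, rfl⟩; exact c.2.2.1 x⟩
  have hΨb : ∀ c, b ≤ Ψ c := fun c =>
    let ⟨x, hx⟩ := hlink c c.2
    hx.trans (le_ciSup (hbdd c) x)
  have hΨ : LowerSemicontinuous Ψ := lowerSemicontinuous_ciSup hbdd fun x =>
    ((heval x).comp continuous_subtype_val).lowerSemicontinuous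
  obtain ⟨c, hc⟩ := exists_ekeland_point hΨ ⟨b, by rintro _ ⟨c, rfl⟩; exact hΨb c⟩ hε
  obtain ⟨s, hs, χ, hχodd, hχ1, hχ⟩ := S.exists_descent_field hwsc
    (neg_deriv_of_even hderiv heven) hδ hε c.1 c.2.1 fun x hx => hgrad _ (c.2.2.1 x) hx
  have hmvt : ∀ x : WeakBall (S.Yk k) ρ, ∃ y : X, ‖y‖ ≤ s ∧
      φ (x.val + (c.1 + s • χ) x) = φ (x.val + c.1 x) + s * φ' (x.val + c.1 x + y) (χ x) := by
    intro x
    obtain ⟨z, hz, h⟩ := domain_mvt (x := x.val + c.1 x) (y := x.val + (c.1 + s • χ) x)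
      (fun u _ => (hderiv u).hasFDerivWithinAt) convex_univ (mem_univ _) (mem_univ _)
    have hsub : x.val + (c.1 + s • χ) x - (x.val + c.1 x) = s • χ x := by
      simp
    rw [hsub, map_smul, smul_eq_mul] at h
    refine ⟨z - (x.val + c.1 x), ?_, ?_⟩
    · refine (norm_sub_le_of_mem_segment hz).trans ?_
      rw [hsub, norm_smul, Real.norm_of_nonneg hs.le]
      exact mul_le_of_le_one_right hs.le (hχ1 x)
    · rw [add_sub_cancel]; linarith
  have hle : ∀ x : WeakBall (S.Yk k) ρ, φ (x.val + (c.1 + s • χ) x) ≤ φ (x.val + c.1 x) := by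
    intro x
    obtain ⟨y, hy, h⟩ := hmvt x
    rw [h]
    nlinarith [(hχ x y hy).1]
  let c' : Γ := ⟨c.1 + s • χ, fun x => by simp [c.2.1, hχodd, add_comm],
    fun x => (hle x).trans (c.2.2.1 x), fun x hx => (hle x).trans (c.2.2.2 x hx)⟩
  have hΨc' : Ψ c' ≤ max (Ψ c - s * ε) t := by
    have : Nonempty (WeakBall (S.Yk k) ρ) := ⟨(hlink c c.2).choose⟩
    refine ciSup_le fun x => ?_
    have hx := le_ciSup (hbdd c) x
    by_cases hτ : δ ≤ S.tauNorm (x.val + c.1 x)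
    · refine le_max_of_le_left ?_
      obtain ⟨y, hy, h⟩ := hmvt x
      change φ (x.val + (c.1 + s • χ) x) ≤ _
      rw [h]
      have := (hχ x y hy).2 hτ
      change _ ≤ Ψ c at hx
      nlinarith
    · exact le_max_of_le_right ((hle x).trans (ht _ (not_le.1 hτ)))
  have hdec : Ψ c' ≤ Ψ c - s * ε :=
    (le_max_iff.1 hΨc').resolve_right fun h => absurd (hΨb c') (by linarith)
  have hdist : dist c' c ≤ s := by
    change dist (c.1 + s • χ) c.1 ≤ s
    rw [dist_self_add_left, norm_smul, Real.norm_of_nonneg hs.le]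
    exact mul_le_of_le_one_right hs.le ((ContinuousMap.norm_le _ zero_le_one).2 hχ1)
  have heq := hc c' (by nlinarith)
  rw [heq] at hdec
  nlinarith [mul_pos hs hε]

end FountainSetup

/-- **The vector field of the deformation lemma (claim (a)–(d) in the proof of Lemma 2.2).**
Under the hypotheses of the deformation lemma, with `R = 2(d_k − b_k + 2ε)/ε + ρ_k + δ`
and `B_R = {‖u‖ ≤ R}`, there is a vector field `χ` on `{φ ≤ d_k + ε}` which is odd, bounded
by `2/ε`, satisfies `⟨∇φ(u), χ(u)⟩ ≤ 0`, is locally Lipschitz and τ-locally Lipschitz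
τ-continuous, satisfies `⟨∇φ(u), χ(u)⟩ < −1` on `φ⁻¹([b_k−ε, d_k+ε)) ∩ B_R`, vanishes for
`‖u‖_τ ≤ 2δ/3`, and locally has finite-dimensional range. -/
theorem deformation_vector_field
    {X : Type*} [NormedAddCommGroup X] [InnerProductSpace ℝ X] [CompleteSpace X]
    (S : FountainSetup X) (φ : X → ℝ) (φ' : X → X →L[ℝ] ℝ)
    -- φ ∈ C¹(X, ℝ)
    (hderiv : ∀ u, HasFDerivAt φ (φ' u) u) (hC1 : Continuous φ')
    -- φ is even
    (heven : ∀ u, φ (-u) = φ u)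
    -- ∇φ is weakly sequentially continuous
    (hwsc : WeaklySeqContDeriv φ')
    (k : ℕ) (ρkv rkv δ : ℝ) (hr : 0 < rkv) (hρr : rkv < ρkv) (hδ : 0 < δ)
    -- the numbers d_k, a_k, b_k and sup_{‖u‖_τ < δ} φ(u)
    (dk ak bk sτ : ℝ)
    (hdk : dk = sSup (φ '' {u : X | u ∈ S.Yk k ∧ ‖u‖ ≤ ρkv}))
    (hak : ak = sSup (φ '' {u : X | u ∈ S.Yk k ∧ ‖u‖ = ρkv}))
    (hbk : bk = sInf (φ '' {u : X | u ∈ S.Zk k ∧ ‖u‖ = rkv}))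
    (hsτ : sτ = sSup (φ '' {u : X | S.tauNorm u < δ}))
    -- finiteness of the various suprema/infima
    (hbdd1 : BddAbove (φ '' {u : X | u ∈ S.Yk k ∧ ‖u‖ ≤ ρkv}))
    (hbdd2 : BddBelow (φ '' {u : X | u ∈ S.Zk k ∧ ‖u‖ ≤ rkv}))
    (hbdd3 : BddBelow (φ '' {u : X | u ∈ S.Zk k ∧ ‖u‖ = rkv}))
    (hbdd4 : BddAbove (φ '' {u : X | S.tauNorm u < δ}))
    -- (A₂)' : a_k < inf {φ(u) : u ∈ Z_k, ‖u‖ ≤ r_k}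
    (hA2' : ak < sInf (φ '' {u : X | u ∈ S.Zk k ∧ ‖u‖ ≤ rkv}))
    -- (2.1) : b_k > sup {φ(u) : ‖u‖_τ < δ}
    (hgap : sτ < bk)
    -- ε ∈ (0, 1/2) with 0 < ε < b_k − max{a_k, sup_{‖u‖_τ<δ} φ(u)}
    (ε : ℝ) (hε0 : 0 < ε) (hε2 : ε < 1 / 2) (hε : ε < bk - max ak sτ)
    -- ‖φ'(u)‖ > ε on E = {u : φ(u) ≤ d_k + 1, ‖u‖_τ ≥ δ/2}
    (hE : ∀ u : X, φ u ≤ dk + 1 → δ / 2 ≤ S.tauNorm u → ε < ‖φ' u‖)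
    -- R = 2(d_k − b_k + 2ε)/ε + ρ_k + δ
    (R : ℝ) (hR : R = 2 * (dk - bk + 2 * ε) / ε + ρkv + δ) :
    ∃ χ : X → X,
      -- (a) χ is odd, ‖χ(u)‖ ≤ 2/ε and ⟨∇φ(u), χ(u)⟩ ≤ 0 on {φ ≤ d_k + ε}
      (∀ u : X, φ u ≤ dk + ε → χ (-u) = -χ u) ∧
      (∀ u : X, φ u ≤ dk + ε → ‖χ u‖ ≤ 2 / ε) ∧
      (∀ u : X, φ u ≤ dk + ε → φ' u (χ u) ≤ 0) ∧
      -- (b) χ is locally Lipschitz continuous on {φ ≤ d_k + ε} …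
      (∀ u : X, φ u ≤ dk + ε → ∃ a : ℝ, 0 < a ∧ ∃ L : ℝ,
        ∀ v w : X, φ v ≤ dk + ε → φ w ≤ dk + ε → ‖v - u‖ < a → ‖w - u‖ < a →
          ‖χ v - χ w‖ ≤ L * ‖v - w‖) ∧
      -- … and τ-locally Lipschitz τ-continuous on {φ ≤ d_k + ε}
      (∀ u : X, φ u ≤ dk + ε → ∃ a : ℝ, 0 < a ∧ ∃ L : ℝ,
        ∀ v w : X, φ v ≤ dk + ε → φ w ≤ dk + ε →
          S.tauNorm (v - u) < a → S.tauNorm (w - u) < a →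
          S.tauNorm (χ v - χ w) ≤ L * S.tauNorm (v - w)) ∧
      -- (c) ⟨∇φ(u), χ(u)⟩ < −1 on φ⁻¹([b_k − ε, d_k + ε)) ∩ B_R
      (∀ u : X, bk - ε ≤ φ u → φ u < dk + ε → ‖u‖ ≤ R → φ' u (χ u) < -1) ∧
      -- (d) χ vanishes for ‖u‖_τ ≤ 2δ/3 …
      (∀ u : X, S.tauNorm u ≤ 2 * δ / 3 → χ u = 0) ∧
      -- … and every point has a τ-open neighborhood whose image under χ is contained
      -- in a finite-dimensional subspace of X
      (∀ u : X, φ u ≤ dk + ε → ∃ a : ℝ, 0 < a ∧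
        ∃ F : Submodule ℝ X, FiniteDimensional ℝ F ∧
          ∀ v : X, φ v ≤ dk + ε → S.tauNorm (v - u) < a → χ v ∈ F) := by
  exfalso
  have hbdd1' : BddAbove (φ '' {u : X | u ∈ S.Yk k ∧ ‖u‖ = ρkv}) :=
    hbdd1.mono (by rintro _ ⟨v, hv, rfl⟩; exact ⟨v, ⟨hv.1, hv.2.le⟩, rfl⟩)
  have hd : ∀ u ∈ S.Yk k, ‖u‖ ≤ ρkv → φ u ≤ dk := fun u hu hn => by
    rw [hdk]; exact le_csSup hbdd1 ⟨u, ⟨hu, hn⟩, rfl⟩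
  have ha : ∀ u ∈ S.Yk k, ‖u‖ = ρkv → φ u ≤ ak := fun u hu hn => by
    rw [hak]; exact le_csSup hbdd1' ⟨u, ⟨hu, hn⟩, rfl⟩
  have ha' : ∀ u ∈ S.Zk k, ‖u‖ ≤ rkv → ak < φ u := fun u hu hn =>
    hA2'.trans_le (csInf_le hbdd2 ⟨u, ⟨hu, hn⟩, rfl⟩)
  have hb : ∀ u ∈ S.Zk k, ‖u‖ = rkv → bk ≤ φ u := fun u hu hn => by
    rw [hbk]; exact csInf_le hbdd3 ⟨u, ⟨hu, hn⟩, rfl⟩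
  have ht : ∀ u, S.tauNorm u < δ → φ u ≤ sτ := fun u hu => by
    rw [hsτ]; exact le_csSup hbdd4 ⟨u, hu, rfl⟩
  obtain ⟨u, hu, hτ, hcrit⟩ := S.exists_almost_critical hderiv heven hwsc (hr.trans hρr) hr hδ
    hε0 hd ha ha' hb ht hgap
  exact absurd hcrit (hE u (by linarith) hτ).not_ge

end
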